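/- arXiv:1903.01052 — 2 statements merged into one kernel-verified Lean document; each statement's English description precedes it below -/
import Mathlib

section
/- For every polynomial f ∈ ℚ[x] of degree d ≥ 2 having a critical point u ∈ ℚ (i.e. f'(u) = 0), there exists a constant M_f > 0, depending only on f and u but not on c, such that for every c ∈ 𝕊_{f,u} the Zsigmondy set Z(f_c, u) has cardinality at most M_f. -/
open Polynomial

/-- The `n`-th term `f_c^n(u) − u` of the sequence associated to `f_c := f + c`
and the point `u`. -/
noncomputable def fcOrbit (f : ℚ[X]) (c u : ℚ) (n : ℕ) : ℚ :=
  (fun x : ℚ => f.eval x + c)^[n] u - u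

/-- A prime `p` is a primitive prime divisor of `f_c^n(u) − u` if
`val_p(f_c^n(u) − u) > 0` and `val_p(f_c^k(u) − u) ≤ 0` for all `1 ≤ k < n`. -/
def HasPrimitivePrimeDivisor (f : ℚ[X]) (c u : ℚ) (n : ℕ) : Prop :=
  ∃ p : ℕ, p.Prime ∧ 0 < padicValRat p (fcOrbit f c u n) ∧
    ∀ k : ℕ, 1 ≤ k → k < n → padicValRat p (fcOrbit f c u k) ≤ 0

/-- The Zsigmondy set `Z(f_c, u)` of the sequence `{f_c^n(u) − u}_{n ≥ 1}`. -/
def Zsig (f : ℚ[X]) (c u : ℚ) : Set ℕ :=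
  {n : ℕ | 1 ≤ n ∧ ¬ HasPrimitivePrimeDivisor f c u n}

/-- `𝕊_{f,u}`: the set of `c ∈ ℚ` such that the sequence `{f_c^n(u) − u}_{n ≥ 1}`
takes infinitely many values. -/
def Sfu (f : ℚ[X]) (u : ℚ) : Set ℚ :=
  {c : ℚ | (Set.range fun n : ℕ => fcOrbit f c u (n + 1)).Infinite}

/-- The orbit of `0` under `x ↦ F(x) + c`. -/
noncomputable def zeroOrbit (F : ℚ[X]) (c : ℚ) (n : ℕ) : ℚ :=
  (fun x : ℚ => F.eval x + c)^[n] 0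

section AbsoluteValues

variable (v : AbsoluteValue ℚ ℝ)

theorem zeroOrbit_zero (F : ℚ[X]) (c : ℚ) : zeroOrbit F c 0 = 0 := rfl

theorem zeroOrbit_succ (F : ℚ[X]) (c : ℚ) (n : ℕ) :
    zeroOrbit F c (n + 1) = F.eval (zeroOrbit F c n) + c :=
  Function.iterate_succ_apply' _ _ _

theorem eval_zero_of_X_sq_dvd {F : ℚ[X]} (hF : X ^ 2 ∣ F) : F.eval 0 = 0 := by
  obtain ⟨H, rfl⟩ := hF
  simp

theorem zeroOrbit_one {F : ℚ[X]} (hF : X ^ 2 ∣ F) (c : ℚ) : zeroOrbit F c 1 = c := by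
  rw [zeroOrbit_succ, zeroOrbit_zero, eval_zero_of_X_sq_dvd hF, zero_add]

theorem iterate_zeroOrbit (F : ℚ[X]) (c : ℚ) (m n : ℕ) :
    (fun x : ℚ => F.eval x + c)^[m] (zeroOrbit F c n) = zeroOrbit F c (m + n) :=
  (Function.iterate_add_apply _ _ _ _).symm

/-- A polynomial is bounded and Lipschitz on balls, for any absolute value. -/
theorem exists_bound_lipschitz (F : ℚ[X]) (R : ℝ) :
    ∃ L : ℝ, ∀ x y : ℚ, v x ≤ R → v y ≤ R →
      v (F.eval x) ≤ L ∧ v (F.eval x - F.eval y) ≤ L * v (x - y) := by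
  induction F using Polynomial.induction_on with
  | C a =>
    refine ⟨v a, fun x y _ _ => ?_⟩
    simp only [eval_C, sub_self, map_zero, le_refl, true_and]
    exact mul_nonneg (v.nonneg _) (v.nonneg _)
  | add p q hp hq =>
    obtain ⟨L₁, h₁⟩ := hp
    obtain ⟨L₂, h₂⟩ := hq
    refine ⟨L₁ + L₂, fun x y hx hy => ?_⟩
    obtain ⟨a₁, b₁⟩ := h₁ x y hx hy
    obtain ⟨a₂, b₂⟩ := h₂ x y hx hy
    simp only [eval_add]
    refine ⟨(v.add_le _ _).trans (by linarith), ?_⟩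
    have : p.eval x + q.eval x - (p.eval y + q.eval y)
      = (p.eval x - p.eval y) + (q.eval x - q.eval y) := by ring
    rw [this]
    exact (v.add_le _ _).trans (by linarith)
  | monomial n a h =>
    obtain ⟨L, h⟩ := h
    refine ⟨max (L * R) (R * L + L), fun x y hx hy => ?_⟩
    obtain ⟨h₁, h₂⟩ := h x y hx hy
    obtain ⟨h₃, -⟩ := h y y hy hy
    have e : ∀ z : ℚ, (C a * X ^ (n + 1) : ℚ[X]).eval z = (C a * X ^ n : ℚ[X]).eval z * z := by
      intro z; simp [pow_succ, mul_assoc]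
    rw [e, e]
    generalize (C a * X ^ n : ℚ[X]).eval x = X₁ at *
    generalize (C a * X ^ n : ℚ[X]).eval y = Y₁ at *
    have hL : 0 ≤ L := (v.nonneg _).trans h₁
    refine ⟨?_, ?_⟩
    · rw [map_mul]
      exact (mul_le_mul h₁ hx (v.nonneg _) hL).trans (le_max_left _ _)
    · have : X₁ * x - Y₁ * y = x * (X₁ - Y₁) + Y₁ * (x - y) := by ring
      rw [this]
      refine (v.add_le _ _).trans ?_
      rw [map_mul, map_mul]
      have h₄ := mul_le_mul hx h₂ (v.nonneg _) ((v.nonneg _).trans hx)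
      have h₅ := mul_le_mul_of_nonneg_right h₃ (v.nonneg (x - y))
      have h₆ := mul_le_mul_of_nonneg_right (le_max_right (L * R) (R * L + L)) (v.nonneg (x - y))
      nlinarith

theorem exists_eval_le_pow (F : ℚ[X]) (n : ℕ) (hn : F.natDegree ≤ n) :
    ∃ B : ℝ, 0 ≤ B ∧ ∀ x : ℚ, 1 ≤ v x → v (F.eval x) ≤ B * v x ^ n := by
  refine ⟨∑ i ∈ Finset.range (F.natDegree + 1), v (F.coeff i),
    Finset.sum_nonneg fun _ _ => v.nonneg _, fun x hx => ?_⟩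
  rw [eval_eq_sum_range, Finset.sum_mul]
  refine (v.sum_le _ _).trans (Finset.sum_le_sum fun i hi => ?_)
  rw [map_mul, map_pow]
  refine mul_le_mul_of_nonneg_left (pow_le_pow_right₀ hx ?_) (v.nonneg _)
  have := Finset.mem_range.1 hi
  omega

/-- Points outside a large disc escape to infinity, uniformly in the parameter. -/
theorem exists_escape_radius (F : ℚ[X]) (hd : 2 ≤ F.natDegree) :
    ∃ R κ : ℝ, 1 ≤ R ∧ 0 < κ ∧ κ ≤ 1 ∧ 2 ≤ κ * R ∧ ∀ c x : ℚ, R ≤ v x → v c ≤ v x →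
      v x ≤ v (F.eval x + c) ∧ (κ * v x) ^ F.natDegree ≤ κ * v (F.eval x + c) := by
  obtain ⟨B, hB, hB'⟩ := exists_eval_le_pow v F.eraseLead (F.natDegree - 1)
    (eraseLead_natDegree_le F)
  have hF : F ≠ 0 := by rintro rfl; simp at hd
  set a := F.leadingCoeff with ha
  have hva : 0 < v a := v.pos (leadingCoeff_ne_zero.2 hF)
  obtain ⟨e, he⟩ : ∃ e, F.natDegree = e + 2 := ⟨F.natDegree - 2, by omega⟩
  have hκ : 0 < min 1 (v a / 2) := by positivity
  set κ := min 1 (v a / 2) with hκd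
  have hκ1 : κ ≤ 1 := min_le_left _ _
  have hκ2 : κ ≤ v a / 2 := min_le_right _ _
  set R := max 1 (max (2 * (B + 1) / v a) (2 / κ)) with hR
  have hR1 : 1 ≤ R := le_max_left _ _
  have hR2 : 2 * (B + 1) ≤ v a * R := by
    have : 2 * (B + 1) / v a ≤ R := (le_max_left _ _).trans (le_max_right _ _)
    rw [div_le_iff₀ hva] at this
    linarith
  have hR3 : 2 ≤ κ * R := by
    have : 2 / κ ≤ R := (le_max_right _ _).trans (le_max_right _ _)
    rw [div_le_iff₀ hκ] at this
    linarith
  refine ⟨R, κ, hR1, hκ, hκ1, hR3, fun c x hx hc => ?_⟩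
  set t := v x with ht
  have ht1 : 1 ≤ t := hR1.trans hx
  have hmain : κ * t ^ (e + 2) ≤ v (F.eval x + c) := by
    have h1 : F.eval x + c = a * x ^ (e + 2) - (-(F.eraseLead.eval x + c)) := by
      conv_lhs => rw [← eraseLead_add_monomial_natDegree_leadingCoeff F]
      rw [eval_add, eval_monomial, he]
      ring
    have h2 : v (a * x ^ (e + 2)) - v (-(F.eraseLead.eval x + c)) ≤ v (F.eval x + c) := by
      rw [h1]; exact v.le_sub _ _
    have h3 : v (-(F.eraseLead.eval x + c)) ≤ (B + 1) * t ^ (e + 1) := by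
      rw [v.map_neg]
      refine (v.add_le _ _).trans ?_
      have h4 := hB' x ht1
      have h5 : F.natDegree - 1 = e + 1 := by omega
      rw [h5] at h4
      have h6 : t ≤ t ^ (e + 1) := le_self_pow₀ ht1 (by omega)
      rw [add_mul, one_mul]
      exact add_le_add h4 (hc.trans h6)
    rw [map_mul, map_pow] at h2
    have h7 : (B + 1) * t ^ (e + 1) ≤ v a / 2 * t ^ (e + 2) := by
      have : t ^ (e + 2) = t * t ^ (e + 1) := by ring
      rw [this, ← mul_assoc]
      refine mul_le_mul_of_nonneg_right ?_ (by positivity)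
      have := mul_le_mul_of_nonneg_left hx hva.le
      linarith
    have h8 : κ * t ^ (e + 2) ≤ v a / 2 * t ^ (e + 2) :=
      mul_le_mul_of_nonneg_right hκ2 (by positivity)
    have h9 : v a * t ^ (e + 2) = v a / 2 * t ^ (e + 2) + v a / 2 * t ^ (e + 2) := by ring
    rw [← ht] at h2
    linarith
  refine ⟨?_, ?_⟩
  · refine le_trans ?_ hmain
    have h1 : 2 ≤ κ * t := hR3.trans (mul_le_mul_of_nonneg_left hx hκ.le)
    have h2 : t ≤ t ^ (e + 1) := le_self_pow₀ ht1 (by omega)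
    have h3 : κ * t ^ (e + 2) = (κ * t) * t ^ (e + 1) := by ring
    rw [h3]
    nlinarith
  · rw [he, mul_pow]
    have h1 : κ ^ (e + 2) ≤ κ * κ := by
      rw [pow_add, sq]
      exact mul_le_of_le_one_left (by positivity) (pow_le_one₀ hκ.le hκ1)
    calc κ ^ (e + 2) * t ^ (e + 2) ≤ κ * κ * t ^ (e + 2) :=
          mul_le_mul_of_nonneg_right h1 (by positivity)
      _ = κ * (κ * t ^ (e + 2)) := by ring
      _ ≤ _ := mul_le_mul_of_nonneg_left hmain hκ.le

theorem escape_orbit {F : ℚ[X]} {R κ : ℝ} (hκ : 0 < κ)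
    (h : ∀ c x : ℚ, R ≤ v x → v c ≤ v x →
      v x ≤ v (F.eval x + c) ∧ (κ * v x) ^ F.natDegree ≤ κ * v (F.eval x + c))
    {c : ℚ} {k : ℕ} (hR : R ≤ v (zeroOrbit F c k)) (hc : v c ≤ v (zeroOrbit F c k)) (j : ℕ) :
    v (zeroOrbit F c k) ≤ v (zeroOrbit F c (k + j)) ∧
      (κ * v (zeroOrbit F c k)) ^ F.natDegree ^ j ≤ κ * v (zeroOrbit F c (k + j)) := by
  induction j with
  | zero => simp
  | succ j ih =>
    obtain ⟨h₁, h₂⟩ := h c (zeroOrbit F c (k + j)) (hR.trans ih.1) (hc.trans ih.1)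
    rw [← zeroOrbit_succ] at h₁ h₂
    refine ⟨ih.1.trans h₁, le_trans ?_ h₂⟩
    rw [pow_succ, pow_mul]
    exact pow_le_pow_left₀ (pow_nonneg (mul_nonneg hκ.le (v.nonneg _)) _) ih.2 _

/-- Near the critical point the orbit is super-attracting, so that it cannot come back much
closer to `0` than its first close return. -/
theorem exists_close_return (F : ℚ[X]) (hF : X ^ 2 ∣ F) (hd : 2 ≤ F.natDegree) :
    ∃ Λ : ℝ, 1 ≤ Λ ∧ ∀ c : ℚ, ∃ m : ℕ, 1 ≤ m ∧ ∀ n : ℕ, 1 ≤ n →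
      (Λ ^ n)⁻¹ ≤ v (zeroOrbit F c n) ∨
        (m ≤ n ∧ v (zeroOrbit F c m) / 2 ≤ v (zeroOrbit F c n)) := by
  obtain ⟨R, κ, hR1, hκ, hκ1, -, hesc⟩ := exists_escape_radius v F hd
  obtain ⟨L₁, hL₁⟩ := exists_bound_lipschitz v F (R + 1)
  obtain ⟨H, hH⟩ := id hF
  obtain ⟨L₂, hL₂⟩ := exists_bound_lipschitz v H (R + 1)
  set L := max 1 (max L₁ L₂) with hL
  have hL1 : 1 ≤ L := le_max_left _ _
  have hLL₁ : L₁ ≤ L := (le_max_left _ _).trans (le_max_right _ _)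
  have hLL₂ : L₂ ≤ L := (le_max_right _ _).trans (le_max_right _ _)
  refine ⟨8 * L, by linarith, fun c => ?_⟩
  have hpos : ∀ n, 0 < (8 * L) ^ n := fun n => by positivity
  have hinv1 : ∀ n, ((8 * L) ^ n)⁻¹ ≤ 1 := fun n =>
    inv_le_one_of_one_le₀ (one_le_pow₀ (by linarith))
  by_cases hall : ∀ n, 1 ≤ n → ((8 * L) ^ n)⁻¹ ≤ v (zeroOrbit F c n)
  · exact ⟨1, le_rfl, fun n hn => Or.inl (hall n hn)⟩
  have hex : ∃ n, 1 ≤ n ∧ v (zeroOrbit F c n) < ((8 * L) ^ n)⁻¹ := by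
    push Not at hall; exact hall
  classical
  obtain ⟨hm1, hm⟩ := Nat.find_spec hex
  have hmin : ∀ n, 1 ≤ n → n < Nat.find hex → ((8 * L) ^ n)⁻¹ ≤ v (zeroOrbit F c n) := by
    intro n hn hlt
    by_contra! hcon
    exact Nat.find_min hex hlt ⟨hn, hcon⟩
  generalize Nat.find hex = m at hm1 hm hmin
  have hcR : v c ≤ R := by
    by_contra! hcon
    have h1 := zeroOrbit_one hF c
    have := (escape_orbit v hκ hesc (k := 1) (c := c) (by rw [h1]; exact hcon.le)
      (by rw [h1]) (m - 1)).1
    rw [h1, show 1 + (m - 1) = m by omega] at this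
    linarith [hinv1 m]
  have hbdd : ∀ j, j ≤ m → v (zeroOrbit F c j) ≤ R := by
    intro j hj
    by_contra! hcon
    have := (escape_orbit v hκ hesc (k := j) (c := c) hcon.le (hcR.trans hcon.le) (m - j)).1
    rw [show j + (m - j) = m by omega] at this
    linarith [hinv1 m]
  set ε := v (zeroOrbit F c m) with hε
  have hε0 : 0 ≤ ε := v.nonneg _
  have hLm : 4 * L ^ m * ε ≤ 1 / 2 := by
    have h1 : ε * (8 * L) ^ m ≤ 1 := by
      have := mul_le_mul_of_nonneg_right hm.le (hpos m).le
      rwa [inv_mul_cancel₀ (hpos m).ne'] at this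
    have h2 : (8 : ℝ) ≤ 8 ^ m := le_self_pow₀ (by norm_num) (by omega)
    rw [mul_pow] at h1
    have h3 : 0 ≤ ε * L ^ m := by positivity
    nlinarith
  have hbd : ∀ y : ℚ, v y ≤ 2 * ε → ∀ j, j ≤ m → L ^ j * v y ^ 2 ≤ ε / 2 := by
    intro y hy j hj
    have h1 : L ^ j ≤ L ^ m := pow_le_pow_right₀ hL1 hj
    have h2 : v y ^ 2 ≤ (2 * ε) ^ 2 := pow_le_pow_left₀ (v.nonneg _) hy 2
    calc L ^ j * v y ^ 2 ≤ L ^ m * (2 * ε) ^ 2 := by gcongr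
      _ = (4 * L ^ m * ε) * ε := by ring
      _ ≤ 1 / 2 * ε := by gcongr
      _ = ε / 2 := by ring
  have hLip : ∀ y : ℚ, v y ≤ 2 * ε → ∀ j, 1 ≤ j → j ≤ m →
      v ((fun x : ℚ => F.eval x + c)^[j] y - zeroOrbit F c j) ≤ L ^ j * v y ^ 2 := by
    intro y hy j hj hjm
    have hε1 : ε ≤ 1 := hm.le.trans (hinv1 m)
    induction j, hj using Nat.le_induction with
    | base =>
      rw [zeroOrbit_one hF, Function.iterate_one]
      have hyR : v y ≤ R + 1 := by linarith
      have h1 : F.eval y + c - c = y ^ 2 * H.eval y := by rw [hH]; simp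
      rw [h1, map_mul, map_pow, pow_one, mul_comm]
      exact mul_le_mul_of_nonneg_right ((hL₂ y y hyR hyR).1.trans hLL₂) (by positivity)
    | succ j hj ih =>
      have ih := ih (by omega)
      have hx := hbdd j (by omega)
      rw [Function.iterate_succ_apply', zeroOrbit_succ]
      generalize (fun x : ℚ => F.eval x + c)^[j] y = z at *
      have hz : v z ≤ R + 1 := by
        have h1 : z = (z - zeroOrbit F c j) + zeroOrbit F c j := by ring
        rw [h1]
        refine (v.add_le _ _).trans ?_
        linarith [hbd y hy j (by omega)]
      have h2 := (hL₁ z (zeroOrbit F c j) hz (by linarith)).2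
      rw [show F.eval z + c - (F.eval (zeroOrbit F c j) + c)
        = F.eval z - F.eval (zeroOrbit F c j) by ring]
      calc _ ≤ L₁ * v (z - zeroOrbit F c j) := h2
        _ ≤ L * v (z - zeroOrbit F c j) := mul_le_mul_of_nonneg_right hLL₁ (v.nonneg _)
        _ ≤ L * (L ^ j * v y ^ 2) := mul_le_mul_of_nonneg_left ih (by linarith)
        _ = _ := by ring
  have hLip' : ∀ y : ℚ, v y ≤ 2 * ε → ∀ j, 1 ≤ j → j ≤ m →
      v ((fun x : ℚ => F.eval x + c)^[j] y - zeroOrbit F c j) ≤ ε / 2 := by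
    intro y hy j hj hjm
    exact (hLip y hy j hj hjm).trans (hbd y hy j hjm)
  have hret : ∀ q : ℕ, v (zeroOrbit F c (q * m)) ≤ 2 * ε := by
    intro q
    induction q with
    | zero => simp [zeroOrbit_zero, hε0]
    | succ q ih =>
      have h1 := hLip' _ ih m hm1 le_rfl
      rw [iterate_zeroOrbit, show m + q * m = (q + 1) * m by ring] at h1
      have h2 : zeroOrbit F c ((q + 1) * m)
        = (zeroOrbit F c ((q + 1) * m) - zeroOrbit F c m) + zeroOrbit F c m := by ring
      rw [h2]
      refine (v.add_le _ _).trans ?_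
      linarith
  refine ⟨m, hm1, fun n hn => ?_⟩
  rcases lt_or_ge n m with hnm | hnm
  · exact Or.inl (hmin n hn hnm)
  refine Or.inr ⟨hnm, ?_⟩
  obtain ⟨q, r, hr1, hrm, rfl⟩ : ∃ q r, 1 ≤ r ∧ r ≤ m ∧ n = r + q * m := by
    refine ⟨(n - 1) / m, (n - 1) % m + 1, by omega, Nat.mod_lt _ (by omega), ?_⟩
    have := Nat.mod_add_div (n - 1) m
    rw [mul_comm] at this
    omega
  have h1 := hLip' _ (hret q) r hr1 hrm
  rw [iterate_zeroOrbit] at h1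
  have h2 : ε ≤ v (zeroOrbit F c r) := by
    rcases hrm.lt_or_eq with hlt | rfl
    · refine hm.le.trans (le_trans ?_ (hmin r hr1 hlt))
      exact inv_anti₀ (hpos r) (pow_le_pow_right₀ (by linarith) hrm)
    · exact le_rfl
  have h3 : v (zeroOrbit F c r) - v (zeroOrbit F c r - zeroOrbit F c (r + q * m))
      ≤ v (zeroOrbit F c (r + q * m)) := by
    have := v.le_sub (zeroOrbit F c r) (zeroOrbit F c r - zeroOrbit F c (r + q * m))
    rwa [sub_sub_cancel] at this
  rw [v.map_sub] at h3
  linarith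

end AbsoluteValues

section Nonarchimedean

variable {v : AbsoluteValue ℚ ℝ}

/-- The valuation ring of a nonarchimedean absolute value. -/
def unitBallSubring (hv : IsNonarchimedean v) : Subring ℚ where
  carrier := {x | v x ≤ 1}
  mul_mem' {a b} ha hb := by
    rw [Set.mem_ofPred_eq, map_mul]
    exact mul_le_one₀ ha (v.nonneg _) hb
  one_mem' := by simp
  add_mem' {a b} ha hb := (hv a b).trans (max_le ha hb)
  zero_mem' := by simp
  neg_mem' {a} ha := by simpa using ha

theorem exists_unitBall_lift (hv : IsNonarchimedean v) {F : ℚ[X]} (hF : X ^ 2 ∣ F)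
    (hcoeff : ∀ i, v (F.coeff i) ≤ 1) :
    ∃ G : (unitBallSubring hv)[X], X ^ 2 ∣ G ∧
      ∀ x : unitBallSubring hv, ((G.eval x : unitBallSubring hv) : ℚ) = F.eval (x : ℚ) := by
  have hsub : (F.coeffs : Set ℚ) ⊆ unitBallSubring hv := by
    intro a ha
    obtain ⟨i, -, rfl⟩ := mem_coeffs_iff.1 ha
    exact hcoeff i
  refine ⟨F.toSubring _ hsub, ?_, fun x => ?_⟩
  · rw [X_pow_dvd_iff] at hF ⊢
    intro i hi
    apply Subtype.ext
    rw [coeff_toSubring, hF i hi]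
    rfl
  · conv_rhs => rw [← map_toSubring F _ hsub]
    exact (eval_map_apply (unitBallSubring hv).subtype x).symm

theorem dvd_iterate_sub_iterate {O : Type*} [CommRing O] (G : O[X]) (hG : X ^ 2 ∣ G) (c y : O)
    (m : ℕ) :
    y ^ 2 ∣ (fun x => G.eval x + c)^[m + 1] y - (fun x => G.eval x + c)^[m + 1] 0 := by
  induction m with
  | zero =>
    obtain ⟨H, rfl⟩ := hG
    simp
  | succ m ih =>
    rw [Function.iterate_succ_apply', Function.iterate_succ_apply' _ (m + 1) 0,
      add_sub_add_right_eq_sub]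
    exact ih.trans (sub_dvd_eval_sub _ _ G)

theorem exists_sq_mul_of_iterate (hv : IsNonarchimedean v) {F : ℚ[X]} (hF : X ^ 2 ∣ F)
    (hcoeff : ∀ i, v (F.coeff i) ≤ 1) {c : ℚ} (hc : v c ≤ 1) :
    (∀ n, v (zeroOrbit F c n) ≤ 1) ∧ ∀ m k, 1 ≤ m →
      ∃ z : ℚ, v z ≤ 1 ∧ zeroOrbit F c (m + k) = zeroOrbit F c m + zeroOrbit F c k ^ 2 * z := by
  obtain ⟨G, hG, hGF⟩ := exists_unitBall_lift hv hF hcoeff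
  let c' : unitBallSubring hv := ⟨c, hc⟩
  have hit : ∀ n (y : unitBallSubring hv), (((fun x => G.eval x + c')^[n] y :
      unitBallSubring hv) : ℚ) = (fun x : ℚ => F.eval x + c)^[n] y := by
    intro n
    induction n with
    | zero => intro y; rfl
    | succ n ih =>
      intro y
      rw [Function.iterate_succ_apply', Function.iterate_succ_apply', ← ih, ← hGF]
      rfl
  have h0 : ∀ n, (((fun x => G.eval x + c')^[n] 0 : unitBallSubring hv) : ℚ)
      = zeroOrbit F c n := fun n => hit n 0
  refine ⟨fun n => ?_, fun m k hm => ?_⟩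
  · rw [← h0]
    exact ((fun x => G.eval x + c')^[n] 0).2
  · obtain ⟨m, rfl⟩ : ∃ m', m = m' + 1 := ⟨m - 1, by omega⟩
    obtain ⟨z, hz⟩ := dvd_iterate_sub_iterate G hG c' ((fun x => G.eval x + c')^[k] 0) m
    refine ⟨z, z.2, ?_⟩
    have hz' := congrArg (Subtype.val) hz
    rw [← Function.iterate_add_apply] at hz'
    push_cast at hz'
    rw [h0, h0, h0] at hz'
    linarith

/-- Rigid divisibility of the orbit of the critical point at a prime of good reduction. -/
theorem exists_dvd_eq_of_lt_one (hv : IsNonarchimedean v) {F : ℚ[X]} (hF : X ^ 2 ∣ F)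
    (hcoeff : ∀ i, v (F.coeff i) ≤ 1) {c : ℚ} (hc : v c ≤ 1) {n j : ℕ}
    (hj : 1 ≤ j) (hjn : j < n) (hvj : v (zeroOrbit F c j) < 1) (hvn : v (zeroOrbit F c n) < 1) :
    ∃ k, 1 ≤ k ∧ k ≤ n / 2 ∧ v (zeroOrbit F c n) = v (zeroOrbit F c k) := by
  obtain ⟨hbdd, hsq⟩ := exists_sq_mul_of_iterate hv hF hcoeff hc
  have hex : ∃ k, 1 ≤ k ∧ v (zeroOrbit F c k) < 1 := ⟨j, hj, hvj⟩
  classical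
  obtain ⟨hk1, hk⟩ := Nat.find_spec hex
  have hkj : Nat.find hex ≤ j := Nat.find_min' hex ⟨hj, hvj⟩
  have hmin : ∀ i, 1 ≤ i → v (zeroOrbit F c i) < 1 → Nat.find hex ≤ i := fun i hi hi' =>
    Nat.find_min' hex ⟨hi, hi'⟩
  generalize Nat.find hex = k at *
  have hmul : ∀ q, 1 ≤ q → v (zeroOrbit F c (q * k)) = v (zeroOrbit F c k) := by
    intro q hq
    induction q, hq using Nat.le_induction with
    | base => rw [one_mul]
    | succ q hq ih =>
      obtain ⟨z, hz, hz'⟩ := hsq k (q * k) hk1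
      rw [show (q + 1) * k = k + q * k by ring, hz']
      rcases eq_or_ne (zeroOrbit F c k) 0 with h0 | h0
      · rw [h0, map_zero] at ih ⊢
        rw [v.eq_zero] at ih
        simp [ih]
      have hpos : 0 < v (zeroOrbit F c k) := v.pos h0
      rw [add_comm]
      refine hv.add_eq_right_of_lt ?_
      rw [map_mul, map_pow, ih]
      have : v (zeroOrbit F c k) ^ 2 * v z ≤ v (zeroOrbit F c k) ^ 2 :=
        mul_le_of_le_one_right (by positivity) hz
      nlinarith
  have hdvd : k ∣ n := by
    by_contra hnd
    have hs : 1 ≤ n % k := Nat.one_le_iff_ne_zero.2 fun h => hnd (Nat.dvd_of_mod_eq_zero h)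
    have hq : 1 ≤ n / k := Nat.div_pos (by omega) hk1
    obtain ⟨z, hz, hz'⟩ := hsq (n % k) (n / k * k) hs
    rw [show n % k + n / k * k = n by rw [mul_comm]; exact Nat.mod_add_div n k] at hz'
    have hlt : v (zeroOrbit F c (n % k)) < 1 := by
      have : zeroOrbit F c (n % k)
        = zeroOrbit F c n + -(zeroOrbit F c (n / k * k) ^ 2 * z) := by linarith
      rw [this]
      refine (hv _ _).trans_lt (max_lt hvn ?_)
      rw [v.map_neg, map_mul, map_pow, hmul _ hq]
      have h1 : v (zeroOrbit F c k) ^ 2 * v z ≤ v (zeroOrbit F c k) ^ 2 :=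
        mul_le_of_le_one_right (by positivity) hz
      exact h1.trans_lt (pow_lt_one₀ (v.nonneg _) hk (by norm_num))
    exact absurd (hmin _ hs hlt) (not_le.2 (Nat.mod_lt _ hk1))
  obtain ⟨q, rfl⟩ := hdvd
  have hq2 : 2 ≤ q := by
    by_contra! hcon
    have : k * q ≤ k * 1 := Nat.mul_le_mul_left k (by omega)
    omega
  refine ⟨k, hk1, ?_, ?_⟩
  · rw [Nat.le_div_iff_mul_le (by norm_num)]
    exact Nat.mul_le_mul_left k hq2
  · rw [mul_comm]
    exact hmul q (by omega)

theorem eval_add_of_one_lt (hv : IsNonarchimedean v) {F : ℚ[X]} (hd : 2 ≤ F.natDegree)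
    (hcoeff : ∀ i, v (F.coeff i) ≤ 1) (hlead : v F.leadingCoeff = 1) {c x : ℚ}
    (hx : 1 < v x) (hc : v c ≤ v x) : v (F.eval x + c) = v x ^ F.natDegree := by
  obtain ⟨e, he⟩ : ∃ e, F.natDegree = e + 2 := ⟨F.natDegree - 2, by omega⟩
  have hlow : v (∑ i ∈ Finset.range (e + 2), F.coeff i * x ^ i) ≤ v x ^ (e + 1) := by
    obtain ⟨i, hi, hle⟩ := hv.finset_image_add_of_nonempty (t := Finset.range (e + 2))
      (fun i => F.coeff i * x ^ i) ⟨0, by simp⟩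
    refine hle.trans ?_
    rw [map_mul, map_pow]
    have := Finset.mem_range.1 hi
    calc v (F.coeff i) * v x ^ i ≤ 1 * v x ^ (e + 1) :=
          mul_le_mul (hcoeff i) (pow_le_pow_right₀ hx.le (by omega)) (by positivity) zero_le_one
      _ = _ := one_mul _
  have h1 : F.eval x + c
      = (∑ i ∈ Finset.range (e + 2), F.coeff i * x ^ i + c) + F.leadingCoeff * x ^ (e + 2) := by
    rw [eval_eq_sum_range, he, Finset.sum_range_succ, leadingCoeff, he]
    ring
  have h2 : v (F.leadingCoeff * x ^ (e + 2)) = v x ^ (e + 2) := by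
    rw [map_mul, hlead, map_pow, one_mul]
  have h3 : v x ^ (e + 1) < v x ^ (e + 2) := pow_lt_pow_right₀ hx (by omega)
  rw [h1, he, ← h2]
  refine hv.add_eq_right_of_lt ?_
  rw [h2]
  refine ((hv _ _).trans (max_le hlow ?_)).trans_lt h3
  exact hc.trans (le_self_pow₀ hx.le (by omega))

theorem zeroOrbit_of_one_lt (hv : IsNonarchimedean v) {F : ℚ[X]} (hF : X ^ 2 ∣ F)
    (hd : 2 ≤ F.natDegree) (hcoeff : ∀ i, v (F.coeff i) ≤ 1) (hlead : v F.leadingCoeff = 1)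
    {c : ℚ} (hc : 1 < v c) (n : ℕ) :
    v (zeroOrbit F c (n + 1)) = v c ^ F.natDegree ^ n := by
  induction n with
  | zero => rw [zeroOrbit_one hF, pow_zero, pow_one]
  | succ n ih =>
    have h0 : F.natDegree ^ n ≠ 0 := pow_ne_zero _ (by omega)
    rw [zeroOrbit_succ, eval_add_of_one_lt hv hd hcoeff hlead, ih, ← pow_mul, ← pow_succ]
    · rw [ih]; exact one_lt_pow₀ hc h0
    · rw [ih]; exact le_self_pow₀ hc.le h0

end Nonarchimedean

section Heights

open Height

/-- The functorial upper bound for heights under a polynomial map. -/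
theorem exists_logHeight_eval_le (F : ℚ[X]) :
    ∃ C : ℝ, ∀ x : ℚ, logHeight₁ (F.eval x) ≤ C + F.natDegree * logHeight₁ x := by
  set d := F.natDegree with hd
  let p : Fin 2 → MvPolynomial (Fin 2) ℚ := ![F.homogenize d, MvPolynomial.X 1 ^ d]
  have hp : ∀ i, (p i).IsHomogeneous d := by
    intro i
    fin_cases i
    · exact isHomogeneous_homogenize F
    · simpa [p] using (MvPolynomial.isHomogeneous_X ℚ (1 : Fin 2)).pow d
  obtain ⟨C, hC⟩ := logHeight_eval_le' hp
  refine ⟨C, fun x => ?_⟩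
  have h := hC ![x, 1]
  rw [← logHeight₁_eq_logHeight] at h
  have h2 : (fun j => MvPolynomial.eval ![x, 1] (p j)) = ![F.eval x, 1] := by
    ext j
    fin_cases j
    · simp only [p, Fin.zero_eta, Matrix.cons_val_zero]
      rw [eval_homogenize le_rfl _ (by simp)]
      simp
    · simp [p]
  rwa [h2, ← logHeight₁_eq_logHeight] at h

theorem exists_logHeight_zeroOrbit_le (F : ℚ[X]) (hd : 2 ≤ F.natDegree) :
    ∃ K : ℝ, 1 ≤ K ∧ ∀ (c : ℚ) (n : ℕ),
      logHeight₁ (zeroOrbit F c n) ≤ F.natDegree ^ n * (logHeight₁ c + K) := by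
  obtain ⟨C, hC⟩ := exists_logHeight_eval_le F
  set A : ℝ := totalWeight ℚ * Real.log 2 with hA
  refine ⟨max 1 (C + A), le_max_left _ _, fun c n => ?_⟩
  set E := logHeight₁ c + max 1 (C + A) with hE
  have hE0 : 0 ≤ E := by
    have := zero_le_logHeight₁ c
    have := le_max_left 1 (C + A)
    linarith
  have hd' : (2 : ℝ) ≤ F.natDegree := by exact_mod_cast hd
  suffices h : logHeight₁ (zeroOrbit F c n) + E ≤ F.natDegree ^ n * E by linarith
  induction n with
  | zero => simp [zeroOrbit_zero]
  | succ n ih =>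
    rw [zeroOrbit_succ]
    have h1 := logHeight₁_add_le (F.eval (zeroOrbit F c n)) c
    have h2 := hC (zeroOrbit F c n)
    have h3 := le_max_right 1 (C + A)
    have h4 := mul_le_mul_of_nonneg_left ih (by linarith : (0 : ℝ) ≤ F.natDegree)
    have h5 := mul_le_mul_of_nonneg_right hd' hE0
    rw [pow_succ]
    linarith

end Heights

section Places

open Height Real

/-- The `p`-adic absolute value at a prime `p`, and the usual absolute value at any other index. -/
noncomputable def placeAbs (p : ℕ) : AbsoluteValue ℚ ℝ :=
  if h : p.Prime then haveI := Fact.mk h; Rat.AbsoluteValue.padic p else Rat.AbsoluteValue.real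

theorem placeAbs_zero (x : ℚ) : placeAbs 0 x = |(x : ℝ)| := by
  simp [placeAbs, Nat.not_prime_zero]

theorem placeAbs_prime {p : ℕ} [hp : Fact p.Prime] (x : ℚ) : placeAbs p x = padicNorm p x := by
  simp [placeAbs, hp.out]

theorem placeAbs_isNonarchimedean {p : ℕ} (hp : p.Prime) : IsNonarchimedean (placeAbs p) := by
  have := Fact.mk hp
  intro x y
  rw [placeAbs_prime, placeAbs_prime, placeAbs_prime]
  exact_mod_cast padicNorm.nonarchimedean

theorem log_placeAbs {p : ℕ} (hp : p.Prime) (x : ℚ) :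
    log (placeAbs p x) = -(padicValRat p x) * log p := by
  have := Fact.mk hp
  rw [placeAbs_prime]
  rcases eq_or_ne x 0 with rfl | hx
  · simp
  · rw [padicNorm.eq_zpow_of_nonzero hx]
    push_cast
    rw [log_zpow]
    push_cast
    ring

theorem padicValRat_pos_iff {p : ℕ} (hp : p.Prime) {x : ℚ} (hx : x ≠ 0) :
    0 < padicValRat p x ↔ placeAbs p x < 1 := by
  have h1 : 0 < log (p : ℝ) := log_pos (by exact_mod_cast hp.one_lt)
  rw [← log_neg_iff ((placeAbs p).pos hx), log_placeAbs hp, neg_mul, neg_lt_zero,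
    mul_pos_iff_of_pos_right h1, Int.cast_pos]

theorem posLog_placeAbs {p : ℕ} (hp : p.Prime) (x : ℚ) :
    posLog (placeAbs p x) = x.den.factorization p * log p := by
  have := Fact.mk hp
  have h1 : 0 ≤ log (p : ℝ) := log_natCast_nonneg p
  rw [posLog_apply, log_placeAbs hp, padicValRat_def, Nat.factorization_def _ hp]
  by_cases h : p ∣ x.den
  · have h2 : padicValInt p x.num = 0 := by
      refine padicValNat.eq_zero_of_not_dvd fun h3 => ?_
      exact Nat.not_coprime_of_dvd_of_dvd hp.one_lt h3 h x.reduced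
    rw [h2]
    simp [h1, mul_nonneg]
  · rw [padicValNat.eq_zero_of_not_dvd h]
    simp [h1, mul_nonneg]

theorem dvd_den_iff_one_lt {p : ℕ} (hp : p.Prime) (x : ℚ) : p ∣ x.den ↔ 1 < placeAbs p x := by
  have h1 : 0 < log (p : ℝ) := log_pos (by exact_mod_cast hp.one_lt)
  have h2 := posLog_placeAbs hp x
  have h3 : p ∣ x.den ↔ x.den.factorization p ≠ 0 := by
    rw [Ne, Nat.factorization_eq_zero_iff]
    simp [hp, x.den_ne_zero]
  rw [h3]
  constructor
  · intro h
    by_contra! hcon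
    rw [(posLog_eq_zero_iff _).2 (by rwa [abs_of_nonneg ((placeAbs p).nonneg _)])] at h2
    have : (0 : ℝ) < x.den.factorization p := by positivity
    exact (mul_pos this h1).ne h2
  · intro h h4
    rw [h4, Nat.cast_zero, zero_mul, posLog_eq_zero_iff,
      abs_of_nonneg ((placeAbs p).nonneg _)] at h2
    linarith

theorem logHeight_eq_log_den (x : ℚ) :
    logHeight₁ x = log x.den + posLog (placeAbs 0 x) := by
  have hd : (0 : ℝ) < x.den := by exact_mod_cast x.den_pos
  rw [Rat.logHeight₁_eq_log_max, posLog_eq_log_max_one ((placeAbs 0).nonneg _),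
    ← log_mul hd.ne' (by positivity), placeAbs_zero]
  congr 1
  rw [mul_max_of_nonneg _ _ hd.le, mul_one, max_comm]
  push_cast
  congr 1
  conv_rhs => rw [Rat.cast_def, abs_div, abs_of_pos hd, mul_div_cancel₀ _ hd.ne']
  rw [Nat.cast_natAbs, Int.cast_abs]

theorem log_den_eq_sum (x : ℚ) (P : Finset ℕ) (hP : ∀ p ∈ P, p.Prime)
    (hsub : x.den.primeFactors ⊆ P) : log x.den = ∑ p ∈ P, posLog (placeAbs p x) := by
  rw [log_nat_eq_sum_factorization, Finsupp.sum, Nat.support_factorization]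
  rw [Finset.sum_subset hsub fun p _ hp => by
    rw [← Nat.support_factorization, Finsupp.notMem_support_iff] at hp; simp [hp]]
  exact Finset.sum_congr rfl fun p hp => (posLog_placeAbs (hP p hp) x).symm

/-- The contribution to the height of `x` of the primes outside `S`. -/
noncomputable def logHeightOutside (S : Finset ℕ) (x : ℚ) : ℝ :=
  ∑ p ∈ x.den.primeFactors \ S, posLog (placeAbs p x)

theorem logHeightOutside_nonneg (S : Finset ℕ) (x : ℚ) : 0 ≤ logHeightOutside S x :=
  Finset.sum_nonneg fun _ _ => posLog_nonneg

theorem logHeight_eq_outside_add (S : Finset ℕ) (hS : ∀ p ∈ S, p.Prime) (x : ℚ) :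
    logHeight₁ x = logHeightOutside S x + ∑ p ∈ insert 0 S, posLog (placeAbs p x) := by
  have h0 : 0 ∉ S := fun h => Nat.not_prime_zero (hS 0 h)
  rw [logHeight_eq_log_den, log_den_eq_sum x (x.den.primeFactors \ S ∪ S) _ _,
    Finset.sum_union Finset.sdiff_disjoint, Finset.sum_insert h0, logHeightOutside]
  · ring
  · intro p hp
    rcases Finset.mem_union.1 hp with h | h
    · exact Nat.prime_of_mem_primeFactors (Finset.mem_sdiff.1 h).1
    · exact hS p h
  · intro p hp
    by_cases h : p ∈ S <;> simp [h, Finset.mem_union, hp]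

theorem sum_posLog_le_logHeight (P : Finset ℕ) (hP : ∀ p ∈ P, p.Prime) (x : ℚ) :
    ∑ p ∈ P, posLog (placeAbs p x) ≤ logHeight₁ x := by
  have h0 : 0 ∉ P := fun h => Nat.not_prime_zero (hP 0 h)
  rw [logHeight_eq_outside_add P hP, Finset.sum_insert h0]
  have := logHeightOutside_nonneg P x
  have : 0 ≤ posLog (placeAbs 0 x) := posLog_nonneg
  linarith

theorem posLog_placeAbs_le_logHeight {S : Finset ℕ} (hS : ∀ p ∈ S, p.Prime) {i : ℕ}
    (hi : i ∈ insert 0 S) (x : ℚ) : posLog (placeAbs i x) ≤ logHeight₁ x := by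
  rw [logHeight_eq_outside_add S hS]
  have h1 := Finset.single_le_sum (f := fun p => posLog (placeAbs p x))
    (fun _ _ => posLog_nonneg) hi
  have h2 := logHeightOutside_nonneg S x
  linarith

/-- All but finitely many primes are primes of good reduction of a polynomial. -/
theorem exists_finset_good_primes {F : ℚ[X]} (hF : F ≠ 0) :
    ∃ S : Finset ℕ, (∀ p ∈ S, p.Prime) ∧ ∀ p : ℕ, p.Prime → p ∉ S →
      (∀ i, placeAbs p (F.coeff i) ≤ 1) ∧ placeAbs p F.leadingCoeff = 1 := by
  have hl : F.leadingCoeff ≠ 0 := leadingCoeff_ne_zero.2 hF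
  refine ⟨(F.support.biUnion fun i => (F.coeff i).den.primeFactors) ∪
    (F.leadingCoeff)⁻¹.den.primeFactors, ?_, ?_⟩
  · intro p hp
    simp only [Finset.mem_union, Finset.mem_biUnion] at hp
    rcases hp with ⟨i, -, h⟩ | h <;> exact Nat.prime_of_mem_primeFactors h
  · intro p hp hpS
    simp only [Finset.mem_union, Finset.mem_biUnion, not_or, not_exists, not_and] at hpS
    have h1 : ∀ i, placeAbs p (F.coeff i) ≤ 1 := by
      intro i
      by_contra! hcon
      rw [← dvd_den_iff_one_lt hp] at hcon
      refine hpS.1 i ?_ (Nat.mem_primeFactors.2 ⟨hp, hcon, Rat.den_ne_zero _⟩)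
      rw [mem_support_iff]
      intro h0
      rw [h0] at hcon
      exact hp.one_lt.ne' (Nat.dvd_one.1 hcon)
    refine ⟨h1, le_antisymm (h1 _) ?_⟩
    by_contra! hcon
    have : 1 < placeAbs p (F.leadingCoeff)⁻¹ := by
      rw [map_inv₀]
      exact (one_lt_inv₀ ((placeAbs p).pos hl)).2 hcon
    rw [← dvd_den_iff_one_lt hp] at this
    exact hpS.2 (Nat.mem_primeFactors.2 ⟨hp, this, Rat.den_ne_zero _⟩)

end Places

section OrbitHeights

open Height Real

variable {F : ℚ[X]} {S : Finset ℕ}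

theorem logHeightOutside_inv_le (hF : X ^ 2 ∣ F) (hd : 2 ≤ F.natDegree)
    (hgood : ∀ p : ℕ, p.Prime → p ∉ S →
      (∀ i, placeAbs p (F.coeff i) ≤ 1) ∧ placeAbs p F.leadingCoeff = 1)
    {c : ℚ} (hne : ∀ n, 1 ≤ n → zeroOrbit F c n ≠ 0) {n : ℕ} (hn : 1 ≤ n)
    (hprim : ∀ p : ℕ, p.Prime → 0 < padicValRat p (zeroOrbit F c n) →
      ∃ k, 1 ≤ k ∧ k < n ∧ 0 < padicValRat p (zeroOrbit F c k)) :
    logHeightOutside S (zeroOrbit F c n)⁻¹ ≤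
      ∑ k ∈ Finset.Icc 1 (n / 2), logHeight₁ (zeroOrbit F c k) := by
  set P := (zeroOrbit F c n)⁻¹.den.primeFactors \ S with hP
  have hPprime : ∀ p ∈ P, p.Prime := fun p hp =>
    Nat.prime_of_mem_primeFactors (Finset.mem_sdiff.1 hp).1
  have key : ∀ p ∈ P, posLog (placeAbs p (zeroOrbit F c n)⁻¹) ≤
      ∑ k ∈ Finset.Icc 1 (n / 2), posLog (placeAbs p (zeroOrbit F c k)⁻¹) := by
    intro p hp
    have hpp := hPprime p hp
    obtain ⟨hp1, hpS⟩ := Finset.mem_sdiff.1 hp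
    obtain ⟨hcoeff, hlead⟩ := hgood p hpp hpS
    have hv := placeAbs_isNonarchimedean hpp
    have hxn : placeAbs p (zeroOrbit F c n) < 1 := by
      have := (dvd_den_iff_one_lt hpp _).1 (Nat.dvd_of_mem_primeFactors hp1)
      rw [map_inv₀] at this
      exact (one_lt_inv₀ ((placeAbs p).pos (hne n hn))).1 this
    have hc : placeAbs p c ≤ 1 := by
      by_contra! hcon
      have h1 := zeroOrbit_of_one_lt hv hF hd hcoeff hlead hcon (n - 1)
      rw [Nat.sub_add_cancel hn] at h1
      rw [h1] at hxn
      exact hxn.not_ge (one_le_pow₀ hcon.le)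
    obtain ⟨j, hj1, hjn, hj⟩ := hprim p hpp ((padicValRat_pos_iff hpp (hne n hn)).2 hxn)
    rw [padicValRat_pos_iff hpp (hne j hj1)] at hj
    obtain ⟨k, hk1, hkn, hk⟩ := exists_dvd_eq_of_lt_one hv hF hcoeff hc hj1 hjn hj hxn
    have h2 := Finset.single_le_sum (f := fun k => posLog (placeAbs p (zeroOrbit F c k)⁻¹))
      (fun _ _ => posLog_nonneg) (Finset.mem_Icc.2 ⟨hk1, hkn⟩)
    refine le_trans (le_of_eq ?_) h2
    rw [map_inv₀, hk, ← map_inv₀]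
  calc logHeightOutside S (zeroOrbit F c n)⁻¹
      ≤ ∑ p ∈ P, ∑ k ∈ Finset.Icc 1 (n / 2), posLog (placeAbs p (zeroOrbit F c k)⁻¹) :=
        Finset.sum_le_sum key
    _ = ∑ k ∈ Finset.Icc 1 (n / 2), ∑ p ∈ P, posLog (placeAbs p (zeroOrbit F c k)⁻¹) :=
        Finset.sum_comm
    _ ≤ _ := Finset.sum_le_sum fun k _ => by
        rw [← logHeight₁_inv (zeroOrbit F c k)]
        exact sum_posLog_le_logHeight P hPprime _

theorem pow_mul_logHeightOutside_le (hF : X ^ 2 ∣ F) (hd : 2 ≤ F.natDegree)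
    (hgood : ∀ p : ℕ, p.Prime → p ∉ S →
      (∀ i, placeAbs p (F.coeff i) ≤ 1) ∧ placeAbs p F.leadingCoeff = 1) (c : ℚ) (n : ℕ) :
    F.natDegree ^ n * logHeightOutside S c ≤ logHeight₁ (zeroOrbit F c (n + 1)) := by
  have hprime : ∀ p ∈ c.den.primeFactors \ S, p.Prime := fun p hp =>
    Nat.prime_of_mem_primeFactors (Finset.mem_sdiff.1 hp).1
  refine le_trans ?_ (sum_posLog_le_logHeight _ hprime _)
  rw [logHeightOutside, Finset.mul_sum]
  refine Finset.sum_le_sum fun p hp => ?_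
  have hpp := hprime p hp
  obtain ⟨hp1, hpS⟩ := Finset.mem_sdiff.1 hp
  obtain ⟨hcoeff, hlead⟩ := hgood p hpp hpS
  have hc := (dvd_den_iff_one_lt hpp _).1 (Nat.dvd_of_mem_primeFactors hp1)
  rw [zeroOrbit_of_one_lt (placeAbs_isNonarchimedean hpp) hF hd hcoeff hlead hc, posLog_eq_log,
    posLog_eq_log, log_pow]
  · push_cast; exact le_rfl
  · rw [abs_of_nonneg (by positivity)]; exact one_le_pow₀ hc.le
  · rw [abs_of_nonneg (by positivity)]; exact hc.le

theorem pow_mul_log_le_logHeight (hS : ∀ p ∈ S, p.Prime) {i : ℕ} (hi : i ∈ insert 0 S)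
    {R κ : ℝ} (hR : 1 ≤ R) (hκ : 0 < κ) (hκ1 : κ ≤ 1)
    (h : ∀ c x : ℚ, R ≤ placeAbs i x → placeAbs i c ≤ placeAbs i x →
      placeAbs i x ≤ placeAbs i (F.eval x + c) ∧
        (κ * placeAbs i x) ^ F.natDegree ≤ κ * placeAbs i (F.eval x + c))
    {c : ℚ} {k : ℕ} (hk : R ≤ placeAbs i (zeroOrbit F c k))
    (hc : placeAbs i c ≤ placeAbs i (zeroOrbit F c k)) (j : ℕ) :
    F.natDegree ^ j * log (κ * placeAbs i (zeroOrbit F c k)) ≤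
      logHeight₁ (zeroOrbit F c (k + j)) := by
  obtain ⟨h1, h2⟩ := escape_orbit (placeAbs i) hκ h hk hc j
  refine le_trans ?_ (posLog_placeAbs_le_logHeight hS hi _)
  have h3 : 0 < placeAbs i (zeroOrbit F c k) := by linarith
  have h4 : 1 ≤ placeAbs i (zeroOrbit F c (k + j)) := by linarith
  rw [posLog_eq_log (by rwa [abs_of_nonneg (by positivity)])]
  have h5 := log_le_log (by positivity) (h2.trans (mul_le_of_le_one_left (by linarith) hκ1))
  rw [log_pow] at h5
  exact_mod_cast h5

theorem exists_logHeight_growth (hF : X ^ 2 ∣ F) (hd : 2 ≤ F.natDegree) (hS : ∀ p ∈ S, p.Prime)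
    (hgood : ∀ p : ℕ, p.Prime → p ∉ S →
      (∀ i, placeAbs p (F.coeff i) ≤ 1) ∧ placeAbs p F.leadingCoeff = 1)
    {c : ℚ} (hc : (Set.range (zeroOrbit F c)).Infinite) :
    ∃ η : ℝ, 0 < η ∧ ∃ k, ∀ j, F.natDegree ^ j * η ≤ logHeight₁ (zeroOrbit F c (k + j)) := by
  rcases (logHeightOutside_nonneg S c).lt_or_eq with hpos | hzero
  · refine ⟨_, hpos, 1, fun j => ?_⟩
    rw [add_comm]
    exact pow_mul_logHeightOutside_le hF hd hgood c j
  have hbdd : ∀ p : ℕ, p.Prime → p ∉ S → ∀ n, placeAbs p (zeroOrbit F c n) ≤ 1 := by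
    intro p hp hpS
    refine (exists_sq_mul_of_iterate (placeAbs_isNonarchimedean hp) hF (hgood p hp hpS).1 ?_).1
    by_contra! hcon
    have hmem : p ∈ c.den.primeFactors \ S := Finset.mem_sdiff.2
      ⟨Nat.mem_primeFactors.2 ⟨hp, (dvd_den_iff_one_lt hp c).2 hcon, c.den_ne_zero⟩, hpS⟩
    have := (Finset.sum_eq_zero_iff_of_nonneg fun _ _ => posLog_nonneg).1 hzero.symm p hmem
    rw [posLog_eq_zero_iff, abs_of_nonneg ((placeAbs p).nonneg _)] at this
    linarith
  choose R κ hR hκ hκ1 hκR hesc using fun i => exists_escape_radius (placeAbs i) F hd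
  by_cases hex : ∃ k, ∃ i ∈ insert 0 S, max (R i) (placeAbs i c) ≤ placeAbs i (zeroOrbit F c k)
  · obtain ⟨k, i, hi, hik⟩ := hex
    have h1 : R i ≤ placeAbs i (zeroOrbit F c k) := (le_max_left _ _).trans hik
    have h2 : 2 ≤ κ i * placeAbs i (zeroOrbit F c k) :=
      (hκR i).trans (mul_le_mul_of_nonneg_left h1 (hκ i).le)
    exact ⟨log (κ i * placeAbs i (zeroOrbit F c k)), log_pos (by linarith), k,
      pow_mul_log_le_logHeight hS hi (hR i) (hκ i) (hκ1 i) (hesc i) h1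
        ((le_max_right _ _).trans hik)⟩
  · push Not at hex
    refine absurd ?_ hc
    refine (NumberField.finite_setOfPred_logHeight₁_le ℚ
      (∑ i ∈ insert 0 S, posLog (max (R i) (placeAbs i c)))).subset ?_
    rintro _ ⟨n, rfl⟩
    rw [Set.mem_ofPred_eq, logHeight_eq_outside_add S hS]
    have h1 : logHeightOutside S (zeroOrbit F c n) = 0 := by
      refine Finset.sum_eq_zero fun p hp => ?_
      obtain ⟨hp1, hpS⟩ := Finset.mem_sdiff.1 hp
      rw [posLog_eq_zero_iff, abs_of_nonneg ((placeAbs p).nonneg _)]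
      exact hbdd p (Nat.prime_of_mem_primeFactors hp1) hpS n
    rw [h1, zero_add]
    exact Finset.sum_le_sum fun i hi =>
      posLog_le_posLog (by linarith [(placeAbs i).nonneg (zeroOrbit F c n)]) (hex n i hi).le

theorem exists_forall_large_logHeight_ge (hF : X ^ 2 ∣ F) (hd : 2 ≤ F.natDegree)
    (hS : ∀ p ∈ S, p.Prime)
    (hgood : ∀ p : ℕ, p.Prime → p ∉ S →
      (∀ i, placeAbs p (F.coeff i) ≤ 1) ∧ placeAbs p F.leadingCoeff = 1) :
    ∃ δ B : ℝ, 0 < δ ∧ ∀ c : ℚ, B ≤ logHeight₁ c → ∀ n,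
      F.natDegree ^ n * (δ * logHeight₁ c) ≤ logHeight₁ (zeroOrbit F c (n + 1)) := by
  choose R κ hR hκ hκ1 hκR hesc using fun i => exists_escape_radius (placeAbs i) F hd
  set T := insert 0 S with hT
  set A : ℝ := ∑ i ∈ T, (log (R i) - log (κ i)) with hA
  have hterm : ∀ i, 0 ≤ log (R i) ∧ log (κ i) ≤ 0 := fun i =>
    ⟨log_nonneg (hR i), log_nonpos (hκ i).le (hκ1 i)⟩
  have hAi : ∀ i ∈ T, log (R i) ≤ A ∧ -log (κ i) ≤ A := by
    intro i hi
    have h1 := Finset.single_le_sum (f := fun i => log (R i) - log (κ i))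
      (fun i _ => by linarith [(hterm i).1, (hterm i).2]) hi
    have h2 := hterm i
    constructor <;> linarith
  have hA0 : 0 ≤ A := Finset.sum_nonneg fun i _ => by linarith [(hterm i).1, (hterm i).2]
  set t : ℝ := T.card + 1 with ht
  have ht0 : 0 < t := by positivity
  refine ⟨(2 * t)⁻¹, 2 * t * (A + 1), by positivity, fun c hc n => ?_⟩
  set e := (2 * t)⁻¹ * logHeight₁ c with he
  have heh : logHeight₁ c = 2 * t * e := by rw [he]; field_simp
  have heA : A + 1 ≤ e := by
    rw [heh] at hc
    exact le_of_mul_le_mul_left hc (mul_pos two_pos ht0)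
  by_cases hout : e ≤ logHeightOutside S c
  · exact (mul_le_mul_of_nonneg_left hout (by positivity)).trans
      (pow_mul_logHeightOutside_le hF hd hgood c n)
  obtain ⟨i, hi, hie⟩ : ∃ i ∈ T, 2 * e ≤ posLog (placeAbs i c) := by
    by_contra! hcon
    have h1 := logHeight_eq_outside_add S hS c
    have h2 : ∑ i ∈ T, posLog (placeAbs i c) ≤ ∑ i ∈ T, 2 * e :=
      Finset.sum_le_sum fun i hi => (hcon i hi).le
    rw [Finset.sum_const, nsmul_eq_mul] at h2
    have h3 : 2 * t * e = T.card * (2 * e) + 2 * e := by rw [ht]; ring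
    linarith
  obtain ⟨hRA, hκA⟩ := hAi i hi
  have hvc : 1 < placeAbs i c := by
    by_contra! hcon
    rw [(posLog_eq_zero_iff _).2 (by rwa [abs_of_nonneg ((placeAbs i).nonneg _)])] at hie
    linarith
  rw [posLog_eq_log (by rw [abs_of_nonneg ((placeAbs i).nonneg _)]; exact hvc.le)] at hie
  have hRc : R i ≤ placeAbs i c :=
    (log_le_log_iff (by linarith [hR i]) (by linarith)).1 (by linarith)
  have h1 := pow_mul_log_le_logHeight hS hi (hR i) (hκ i) (hκ1 i) (hesc i) (c := c) (k := 1)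
    (by rwa [zeroOrbit_one hF]) (by rw [zeroOrbit_one hF]) n
  rw [zeroOrbit_one hF, log_mul (hκ i).ne' (by linarith), add_comm 1 n] at h1
  exact (mul_le_mul_of_nonneg_left (by linarith) (by positivity)).trans h1

/-- The heights along infinite orbits of `0` grow uniformly in the parameter. -/
theorem exists_uniform_logHeight_ge (hF : X ^ 2 ∣ F) (hd : 2 ≤ F.natDegree)
    (hS : ∀ p ∈ S, p.Prime)
    (hgood : ∀ p : ℕ, p.Prime → p ∉ S →
      (∀ i, placeAbs p (F.coeff i) ≤ 1) ∧ placeAbs p F.leadingCoeff = 1)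
    {K : ℝ} (hK : 0 < K) :
    ∃ δ : ℝ, 0 < δ ∧ ∃ N : ℕ, ∀ c : ℚ, (Set.range (zeroOrbit F c)).Infinite → ∀ n, N ≤ n →
      δ * (F.natDegree ^ n * (logHeight₁ c + K)) ≤ logHeight₁ (zeroOrbit F c n) := by
  have hd0 : (0 : ℝ) < F.natDegree := by exact_mod_cast (by omega : 0 < F.natDegree)
  have hE : ∀ c : ℚ, 0 < logHeight₁ c + K := fun c => by
    linarith [zero_le_logHeight₁ c]
  obtain ⟨δ₁, B, hδ₁, hlarge⟩ := exists_forall_large_logHeight_ge hF hd hS hgood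
  have hsmall : ∀ A : Set ℚ, A.Finite → ∃ δ : ℝ, 0 < δ ∧ ∃ N : ℕ, ∀ c ∈ A,
      (Set.range (zeroOrbit F c)).Infinite → ∀ n, N ≤ n →
      δ * (F.natDegree ^ n * (logHeight₁ c + K)) ≤ logHeight₁ (zeroOrbit F c n) := by
    intro A hA
    induction A, hA using Set.Finite.induction_on with
    | empty => exact ⟨1, one_pos, 0, fun _ h => absurd h (Set.notMem_empty _)⟩
    | @insert a A _ _ ih =>
      obtain ⟨δ, hδ, N, h⟩ := ih
      by_cases ha : (Set.range (zeroOrbit F a)).Infinite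
      · obtain ⟨η, hη, k, hk⟩ := exists_logHeight_growth hF hd hS hgood ha
        have hE0 := hE a
        refine ⟨min δ (η / (F.natDegree ^ k * (logHeight₁ a + K))), by positivity, max N k,
          fun c hc hinf n hn => ?_⟩
        rcases Set.mem_insert_iff.1 hc with rfl | hc
        · obtain ⟨j, rfl⟩ := Nat.exists_eq_add_of_le ((le_max_right _ _).trans hn)
          refine le_trans ?_ (hk j)
          refine (mul_le_mul_of_nonneg_right (min_le_right _ _) (by positivity)).trans
            (le_of_eq ?_)
          rw [pow_add]
          field_simp
        · exact (mul_le_mul_of_nonneg_right (min_le_left _ _)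
            (mul_nonneg (by positivity) (hE c).le)).trans
            (h c hc hinf n ((le_max_left _ _).trans hn))
      · refine ⟨δ, hδ, N, fun c hc hinf n hn => ?_⟩
        rcases Set.mem_insert_iff.1 hc with rfl | hc
        · exact absurd hinf ha
        · exact h c hc hinf n hn
  obtain ⟨δ₂, hδ₂, N, hN⟩ := hsmall _
    (NumberField.finite_setOfPred_logHeight₁_le ℚ (max B K))
  refine ⟨min δ₂ (δ₁ / (2 * F.natDegree)), by positivity, max N 1, fun c hinf n hn => ?_⟩
  have hEc : 0 ≤ (F.natDegree : ℝ) ^ n * (logHeight₁ c + K) :=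
    mul_nonneg (by positivity) (hE c).le
  by_cases hc : logHeight₁ c ≤ max B K
  · exact (mul_le_mul_of_nonneg_right (min_le_left _ _) hEc).trans
      (hN c hc hinf n ((le_max_left _ _).trans hn))
  · push Not at hc
    obtain ⟨m, rfl⟩ : ∃ m, n = m + 1 := ⟨n - 1, by have := (le_max_right _ _).trans hn; omega⟩
    refine (mul_le_mul_of_nonneg_right (min_le_right _ _) hEc).trans ?_
    refine le_trans ?_ (hlarge c ((le_max_left _ _).trans hc.le) m)
    have h1 : logHeight₁ c + K ≤ 2 * logHeight₁ c := by
      linarith [(le_max_right B K).trans hc.le]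
    calc δ₁ / (2 * F.natDegree) * (F.natDegree ^ (m + 1) * (logHeight₁ c + K))
        ≤ δ₁ / (2 * F.natDegree) * (F.natDegree ^ (m + 1) * (2 * logHeight₁ c)) := by gcongr
      _ = F.natDegree ^ m * (δ₁ * logHeight₁ c) := by
        rw [pow_succ]
        field_simp

theorem zeroOrbit_ne_zero {F : ℚ[X]} {c : ℚ} (hc : (Set.range (zeroOrbit F c)).Infinite)
    {n : ℕ} (hn : 1 ≤ n) : zeroOrbit F c n ≠ 0 := by
  intro h
  refine hc (((Finset.range n).image (zeroOrbit F c)).finite_toSet.subset ?_)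
  have hper : ∀ q r, zeroOrbit F c (n * q + r) = zeroOrbit F c r := by
    have hfix : Function.IsPeriodicPt (fun x => F.eval x + c) n 0 := h
    intro q r
    rw [zeroOrbit, add_comm, Function.iterate_add_apply, (hfix.mul_const q).eq, zeroOrbit]
  rintro _ ⟨k, rfl⟩
  rw [← Nat.div_add_mod k n, hper]
  exact Finset.mem_coe.2 (Finset.mem_image_of_mem _ (Finset.mem_range.2 (Nat.mod_lt _ hn)))

theorem exists_posLog_inv_le (hS : ∀ p ∈ S, p.Prime) {i : ℕ} (hi : i ∈ insert 0 S)
    (hF : X ^ 2 ∣ F) (hd : 2 ≤ F.natDegree) :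
    ∃ L : ℝ, 0 ≤ L ∧ ∀ c, (Set.range (zeroOrbit F c)).Infinite → ∃ m, ∀ n, 1 ≤ n →
      posLog (placeAbs i (zeroOrbit F c n)⁻¹) ≤ n * L ∨
        (m ≤ n ∧ posLog (placeAbs i (zeroOrbit F c n)⁻¹) ≤
          log 2 + logHeight₁ (zeroOrbit F c m)) := by
  obtain ⟨Λ, hΛ, h⟩ := exists_close_return (placeAbs i) F hF hd
  refine ⟨log Λ, log_nonneg hΛ, fun c hc => ?_⟩
  obtain ⟨m, hm, hmn⟩ := h c
  refine ⟨m, fun n hn => ?_⟩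
  have hxn := (placeAbs i).pos (zeroOrbit_ne_zero hc hn)
  have hxm := (placeAbs i).pos (zeroOrbit_ne_zero hc hm)
  rw [map_inv₀]
  refine (hmn n hn).imp (fun hle => ?_) fun hle => ⟨hle.1, ?_⟩
  · have hpow : 1 ≤ Λ ^ n := one_le_pow₀ hΛ
    have hle' : (placeAbs i (zeroOrbit F c n))⁻¹ ≤ Λ ^ n :=
      inv_le_of_inv_le₀ (by positivity) hle
    refine (posLog_le_posLog (by positivity) hle').trans_eq ?_
    rw [posLog_eq_log (by rwa [abs_of_pos (by positivity)]), log_pow]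
  · have hle' : (placeAbs i (zeroOrbit F c n))⁻¹ ≤ 2 * (placeAbs i (zeroOrbit F c m))⁻¹ := by
      refine (inv_anti₀ (by positivity) hle.2).trans_eq ?_
      rw [inv_div, div_eq_mul_inv]
    refine (posLog_le_posLog (by positivity) hle').trans (posLog_mul.trans ?_)
    rw [← logHeight₁_inv, posLog_eq_log (by norm_num : 1 ≤ |(2 : ℝ)|), ← map_inv₀]
    gcongr
    exact posLog_placeAbs_le_logHeight hS hi _

theorem exists_forall_pow_half_lt {d : ℕ} (hd : 2 ≤ d) {ε : ℝ} (hε : 0 < ε) (A B : ℝ) :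
    ∃ N : ℕ, ∀ n, N ≤ n → (d : ℝ) ^ (n / 2 + 1) + n * A + B < ε * d ^ n := by
  have hd1 : (1 : ℝ) < d := by exact_mod_cast hd
  have hd0 : (0 : ℝ) < d := by positivity
  have h1 : Filter.Tendsto (fun n : ℕ => (d : ℝ) ^ (n / 2 + 1) / d ^ n) Filter.atTop (nhds 0) := by
    have hs : Filter.Tendsto (fun n : ℕ => (d : ℝ)⁻¹ ^ (n / 2)) Filter.atTop (nhds 0) :=
      (tendsto_pow_atTop_nhds_zero_of_lt_one (by positivity) (inv_lt_one_of_one_lt₀ hd1)).comp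
        (Nat.tendsto_div_const_atTop two_ne_zero)
    refine squeeze_zero (fun n => by positivity) (fun n => ?_) (by simpa using hs.const_mul (d : ℝ))
    rw [div_le_iff₀ (by positivity), pow_succ]
    have : (d : ℝ) ^ (n / 2) * d ^ (n / 2) ≤ d ^ n := by
      rw [← pow_add]
      exact pow_le_pow_right₀ hd1.le (by omega)
    have hpos : (0 : ℝ) < d ^ (n / 2) := by positivity
    rw [mul_assoc, mul_comm, mul_le_mul_iff_right₀ hd0, inv_mul_eq_div, le_div_iff₀ hpos]
    exact this
  have h2 : Filter.Tendsto (fun n : ℕ => (n : ℝ) / d ^ n) Filter.atTop (nhds 0) := by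
    simpa using tendsto_pow_const_div_const_pow_of_one_lt 1 hd1
  have h3 : Filter.Tendsto (fun n : ℕ => 1 / (d : ℝ) ^ n) Filter.atTop (nhds 0) := by
    simpa using tendsto_pow_const_div_const_pow_of_one_lt 0 hd1
  have h := (h1.add (h2.mul_const A)).add (h3.mul_const B)
  simp only [zero_mul, add_zero] at h
  obtain ⟨N, hN⟩ := Filter.eventually_atTop.1 (h.eventually_lt_const hε)
  refine ⟨N, fun n hn => ?_⟩
  have := hN n hn
  rw [← div_lt_iff₀ (by positivity)]
  refine lt_of_eq_of_lt ?_ this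
  ring

theorem sum_Icc_pow_le {d : ℕ} (hd : 2 ≤ d) (n : ℕ) :
    ∑ k ∈ Finset.Icc 1 n, (d : ℝ) ^ k ≤ d ^ (n + 1) := by
  have hd2 : (2 : ℝ) ≤ d := by exact_mod_cast hd
  induction n with
  | zero => simp
  | succ n ih =>
    rw [Finset.sum_Icc_succ_top (by omega), pow_succ (d : ℝ) (n + 1)]
    have : (0 : ℝ) ≤ d ^ (n + 1) := by positivity
    nlinarith

/-- The main bound, for polynomials with a critical fixed point at the origin. -/
theorem exists_bound_of_sq_dvd (hF : X ^ 2 ∣ F) (hd : 2 ≤ F.natDegree) :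
    ∃ M : ℕ, ∀ c, (Set.range (zeroOrbit F c)).Infinite → ∃ Z : Finset ℕ, Z.card ≤ M ∧
      ∀ n, 1 ≤ n → (∀ p : ℕ, p.Prime → 0 < padicValRat p (zeroOrbit F c n) →
        ∃ k, 1 ≤ k ∧ k < n ∧ 0 < padicValRat p (zeroOrbit F c k)) → n ∈ Z := by
  have hF0 : F ≠ 0 := by rintro rfl; simp at hd
  have hd1 : (1 : ℝ) < F.natDegree := by exact_mod_cast hd
  obtain ⟨S, hS, hgood⟩ := exists_finset_good_primes hF0
  obtain ⟨K, hK, hup⟩ := exists_logHeight_zeroOrbit_le F hd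
  obtain ⟨δ, hδ, N, hlow⟩ := exists_uniform_logHeight_ge hF hd hS hgood (zero_lt_one.trans_le hK)
  set T := insert 0 S with hT
  choose! L hL hplace using fun i (hi : i ∈ T) => exists_posLog_inv_le hS hi hF hd
  obtain ⟨s, hs⟩ := pow_unbounded_of_one_lt (T.card / (δ / 2)) hd1
  obtain ⟨N', hN'⟩ := exists_forall_pow_half_lt hd (half_pos hδ) (∑ i ∈ T, L i)
    (T.card * log 2)
  refine ⟨max N N' + T.card * s, fun c hc => ?_⟩
  choose! m hm using fun i (hi : i ∈ T) => hplace i hi c hc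
  refine ⟨Finset.range (max N N') ∪ T.biUnion fun i => Finset.Ico (m i) (m i + s), ?_, ?_⟩
  · refine (Finset.card_union_le _ _).trans (add_le_add (Finset.card_range _).le ?_)
    exact Finset.card_biUnion_le_card_mul _ _ _ fun i _ => by simp
  intro n hn hprim
  by_contra hnZ
  simp only [Finset.mem_union, Finset.mem_range, Finset.mem_biUnion, Finset.mem_Ico, not_or,
    not_exists, not_and, not_lt, max_le_iff] at hnZ
  obtain ⟨⟨hNn, hN'n⟩, hout⟩ := hnZ
  set E := logHeight₁ c + K with hE
  have hE1 : 1 ≤ E := by linarith [zero_le_logHeight₁ c]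
  have hlog2 : 0 ≤ log 2 := log_nonneg one_le_two
  set D : ℝ := (F.natDegree : ℝ) with hD
  have hterm : ∀ i ∈ T, posLog (placeAbs i (zeroOrbit F c n)⁻¹) ≤
      n * L i + log 2 + D ^ n / D ^ s * E := by
    intro i hi
    have hLi := hL i hi
    rcases hm i hi n hn with h | ⟨hmn, h⟩
    · have : 0 ≤ D ^ n / D ^ s * E := by positivity
      linarith
    · have hmsn := hout i hi hmn
      have hpow : D ^ m i ≤ D ^ n / D ^ s := by
        rw [le_div_iff₀ (by positivity), ← pow_add]
        exact pow_le_pow_right₀ hd1.le hmsn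
      have := mul_le_mul_of_nonneg_right hpow (zero_le_one.trans hE1)
      have := hup c (m i)
      have : 0 ≤ n * L i := by positivity
      linarith
  have hsum : ∑ i ∈ T, posLog (placeAbs i (zeroOrbit F c n)⁻¹) ≤
      n * ∑ i ∈ T, L i + T.card * log 2 + δ / 2 * D ^ n * E := by
    refine (Finset.sum_le_sum hterm).trans ?_
    rw [Finset.sum_add_distrib, Finset.sum_add_distrib, ← Finset.mul_sum, Finset.sum_const,
      Finset.sum_const, nsmul_eq_mul, nsmul_eq_mul, ← mul_assoc]
    gcongr _ + ?_ * E
    rw [div_lt_iff₀ (half_pos hδ)] at hs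
    rw [mul_div_assoc', div_le_iff₀ (by positivity), mul_right_comm]
    gcongr
    exact hs.le.trans_eq (mul_comm _ _)
  have hOut : logHeightOutside S (zeroOrbit F c n)⁻¹ ≤ D ^ (n / 2 + 1) * E := by
    refine (logHeightOutside_inv_le hF hd hgood (fun k hk => zeroOrbit_ne_zero hc hk) hn
      hprim).trans ?_
    refine (Finset.sum_le_sum fun k _ => hup c k).trans ?_
    rw [← Finset.sum_mul]
    exact mul_le_mul_of_nonneg_right (sum_Icc_pow_le hd _) (by positivity)
  have hmain := hlow c hc n hNn
  rw [← logHeight₁_inv (zeroOrbit F c n), logHeight_eq_outside_add S hS (zeroOrbit F c n)⁻¹,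
    ← hE, ← hT] at hmain
  have hlt := mul_lt_mul_of_pos_right (hN' n hN'n) (zero_lt_one.trans_le hE1)
  have hnonneg : 0 ≤ n * ∑ i ∈ T, L i + T.card * log 2 := by
    have := Finset.sum_nonneg hL
    positivity
  have := le_mul_of_one_le_right hnonneg hE1
  nlinarith

end OrbitHeights

/-- The polynomial `f`, translated so that the critical point and its value are both `0`. -/
noncomputable def recenter (f : ℚ[X]) (u : ℚ) : ℚ[X] := f.comp (X + C u) - C (f.eval u)

theorem eval_recenter (f : ℚ[X]) (u x : ℚ) :
    (recenter f u).eval x = f.eval (x + u) - f.eval u := by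
  simp [recenter]

theorem natDegree_recenter (f : ℚ[X]) (u : ℚ) : (recenter f u).natDegree = f.natDegree := by
  rw [recenter, natDegree_sub_C, natDegree_comp, natDegree_X_add_C, mul_one]

theorem sq_dvd_recenter {f : ℚ[X]} {u : ℚ} (h : f.derivative.eval u = 0) :
    X ^ 2 ∣ recenter f u := by
  rw [X_pow_dvd_iff]
  intro k hk
  interval_cases k
  · rw [coeff_zero_eq_eval_zero, eval_recenter, zero_add, sub_self]
  · have h1 : (derivative (recenter f u)).coeff 0 = 0 := by
      rw [coeff_zero_eq_eval_zero]
      simp [recenter, derivative_comp, h]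
    simpa [coeff_derivative] using h1

theorem fcOrbit_eq_zeroOrbit (f : ℚ[X]) (c u : ℚ) (n : ℕ) :
    fcOrbit f c u n = zeroOrbit (recenter f u) (f.eval u + c - u) n := by
  induction n with
  | zero => simp [fcOrbit, zeroOrbit_zero]
  | succ n ih =>
    rw [zeroOrbit_succ, ← ih, eval_recenter, fcOrbit, fcOrbit, Function.iterate_succ_apply',
      sub_add_cancel]
    ring

/-- Theorem 1.2: for every `f ∈ ℚ[x]` of degree `d ≥ 2` with a rational critical
point `u`, there is a constant `M_f > 0`, independent of `c`, such that
`#Z(f_c, u) ≤ M_f` for every `c ∈ 𝕊_{f,u}`. -/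
theorem zsigmondy_bound_critical_orbit (f : ℚ[X]) (u : ℚ)
    (hdeg : 2 ≤ f.natDegree) (hcrit : f.derivative.eval u = 0) :
    ∃ M : ℕ, 0 < M ∧ ∀ c ∈ Sfu f u,
      (Zsig f c u).Finite ∧ (Zsig f c u).ncard ≤ M := by
  obtain ⟨M, hM⟩ := exists_bound_of_sq_dvd (sq_dvd_recenter hcrit)
    (hdeg.trans_eq (natDegree_recenter f u).symm)
  refine ⟨M + 1, M.succ_pos, fun c hc => ?_⟩
  obtain ⟨Z, hZ, hmem⟩ := hM (f.eval u + c - u) <| Set.Infinite.mono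
    (by rintro _ ⟨n, rfl⟩; exact ⟨n + 1, (fcOrbit_eq_zeroOrbit f c u (n + 1)).symm⟩) hc
  have hsub : Zsig f c u ⊆ Z := by
    rintro n ⟨hn, hprim⟩
    refine hmem n hn fun p hp hpos => ?_
    by_contra! hcon
    refine hprim ⟨p, hp, by rwa [fcOrbit_eq_zeroOrbit], fun k hk hkn => ?_⟩
    rw [fcOrbit_eq_zeroOrbit]
    exact hcon k hk hkn
  refine ⟨Z.finite_toSet.subset hsub, ?_⟩
  have := Set.ncard_le_ncard hsub Z.finite_toSet
  rw [Set.ncard_coe_finset] at this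
  omega
end

section
/- Every x²-divisible polynomial g ∈ ℤ[x] of degree d ≥ 3 has rapidly increasing numerators on S_g; that is, there exists an integer N > 0 such that for every c ∈ S_g there is a finite set J_c ⊆ ℕ with #J_c ≤ N such that for every n ∉ J_c one has ln|A_n| > Σ_{p|n} ln|A_{n/p}|, the sum being over the distinct prime divisors p of n. -/
open Polynomial

/-- The `n`-th iterate of `g_c := g + c` applied to `0`, for `g ∈ ℤ[x]` and `c ∈ ℚ`. -/
noncomputable def gcIter (g : ℤ[X]) (c : ℚ) (n : ℕ) : ℚ :=
  (fun x : ℚ => (g.map (Int.castRingHom ℚ)).eval x + c)^[n] 0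

/-- `g` is `x²`-divisible: degree at least 2 and zero constant and linear coefficients. -/
def IsX2Divisible (g : ℤ[X]) : Prop :=
  2 ≤ g.natDegree ∧ g.coeff 0 = 0 ∧ g.coeff 1 = 0

/-- The length `L_g = 1 + ∑_{i=2}^{d-1} |u_i|/|u_d|` of an `x²`-divisible polynomial. -/
noncomputable def Lg (g : ℤ[X]) : ℝ :=
  1 + ∑ i ∈ Finset.Ico 2 g.natDegree, (|g.coeff i| : ℝ) / (|g.leadingCoeff| : ℝ)

/-- `S_g`: the set of `c ∈ ℚ` such that the sequence `{g_c^n(0)}_{n ≥ 1}` takes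
infinitely many values. -/
def Sg (g : ℤ[X]) : Set ℚ :=
  {c : ℚ | (Set.range fun n : ℕ => gcIter g c (n + 1)).Infinite}

/-- The numerator `A_n` of `g_c^{n+1}(0) = g_c^n(c) = A_n / B_n` in lowest terms. -/
noncomputable def An (g : ℤ[X]) (c : ℚ) (n : ℕ) : ℤ := (gcIter g c (n + 1)).num

/-- The (positive) denominator `B_n` of `g_c^{n+1}(0) = g_c^n(c) = A_n / B_n`
in lowest terms. -/
noncomputable def Bn (g : ℤ[X]) (c : ℚ) (n : ℕ) : ℕ := (gcIter g c (n + 1)).den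

/-- For a natural number `a`, the factor `â = ∏_{p ∈ I(a)} p^{val_p(a)}`, where
`I(a)` consists of the primes `p` with `val_p(a) > val_p(u_d)`. -/
noncomputable def hatB (g : ℤ[X]) (a : ℕ) : ℕ :=
  ∏ p ∈ a.primeFactors.filter
      (fun p => padicValInt p g.leadingCoeff < padicValNat p a),
    p ^ padicValNat p a

/-- `g` has rapidly increasing numerators on `S`: there is an integer `N > 0` such that
for every `c ∈ S` there is a finite set `J_c ⊆ ℕ` with `#J_c ≤ N` such that for every
`n ≥ 1` outside `J_c` one has `ln |A_n| > ∑_{p ∣ n} ln |A_{n/p}|`. -/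
def RapidlyIncreasingNumerators (g : ℤ[X]) (S : Set ℚ) : Prop :=
  ∃ N : ℕ, 0 < N ∧ ∀ c ∈ S, ∃ J : Finset ℕ, J.card ≤ N ∧
    ∀ n : ℕ, 1 ≤ n → n ∉ J →
      (∑ p ∈ n.primeFactors, Real.log |(An g c (n / p) : ℝ)|) <
        Real.log |(An g c n : ℝ)|

section Padic

variable {p : ℕ} [Fact p.Prime]

lemma padicNorm_den_mul_max (x : ℚ) : padicNorm p (x.den : ℚ) * max 1 (padicNorm p x) = 1 := by
  have hx : padicNorm p x * padicNorm p (x.den : ℚ) = padicNorm p (x.num : ℚ) := by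
    rw [← padicNorm.mul, Rat.mul_den_eq_num]
  by_cases h : p ∣ x.den
  · have hn : padicNorm p (x.num : ℚ) = 1 := by
      rw [padicNorm.int_eq_one_iff]
      intro h'
      have h1 : p ∣ x.num.natAbs := Int.natCast_dvd.mp h'
      exact (Fact.out : p.Prime).one_lt.ne' (Nat.dvd_one.mp (x.reduced ▸ Nat.dvd_gcd h1 h))
    have hd : padicNorm p (x.den : ℚ) ≤ 1 := by
      simpa using padicNorm.of_int (p := p) (x.den : ℤ)
    have hx0 : 0 ≤ padicNorm p x := padicNorm.nonneg x
    have : 1 ≤ padicNorm p x := by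
      rw [hn] at hx
      nlinarith
    rw [max_eq_right this, mul_comm, hx, hn]
  · have hd : padicNorm p (x.den : ℚ) = 1 := (padicNorm.nat_eq_one_iff (p := p) x.den).mpr h
    have : padicNorm p x ≤ 1 := by
      rw [hd, mul_one] at hx
      rw [hx]
      exact padicNorm.of_int x.num
    rw [max_eq_left this, hd, mul_one]

/-- Where the leading term dominates `p`-adically, it determines the norm of `g(x) + c`. -/
lemma padicNorm_eval_add_of_lt {g : ℤ[X]} (hd : 2 ≤ g.natDegree) {x c : ℚ}
    (hx : 1 < padicNorm p (g.leadingCoeff : ℚ) * padicNorm p x)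
    (hc : padicNorm p c ≤ padicNorm p x) :
    padicNorm p ((g.map (Int.castRingHom ℚ)).eval x + c) =
      padicNorm p (g.leadingCoeff : ℚ) * padicNorm p x ^ g.natDegree := by
  have hu : padicNorm p (g.leadingCoeff : ℚ) ≤ 1 := padicNorm.of_int _
  have hx0 : 0 ≤ padicNorm p x := padicNorm.nonneg x
  have hx1 : 1 ≤ padicNorm p x := by nlinarith
  have hpow : ∀ k, padicNorm p (x ^ k) = padicNorm p x ^ k := fun k => by
    induction k with
    | zero => simp
    | succ k ih => rw [pow_succ, padicNorm.mul, ih, pow_succ]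
  have heval : (g.map (Int.castRingHom ℚ)).eval x + c =
      (g.leadingCoeff : ℚ) * x ^ g.natDegree +
        (∑ i ∈ Finset.range g.natDegree, (g.coeff i : ℚ) * x ^ i + c) := by
    rw [eval_map, eval₂_eq_sum_range, Finset.sum_range_succ]
    simp only [eq_intCast, coeff_natDegree]
    ring
  have hlead : padicNorm p ((g.leadingCoeff : ℚ) * x ^ g.natDegree) =
      padicNorm p (g.leadingCoeff : ℚ) * padicNorm p x ^ g.natDegree := by
    rw [padicNorm.mul, hpow]
  have hlow : padicNorm p (∑ i ∈ Finset.range g.natDegree, (g.coeff i : ℚ) * x ^ i + c) ≤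
      padicNorm p x ^ (g.natDegree - 1) := by
    refine padicNorm.nonarchimedean.trans (max_le ?_ ?_)
    · refine padicNorm.sum_le' (fun i hi => ?_) (by positivity)
      rw [padicNorm.mul, hpow]
      calc padicNorm p (g.coeff i : ℚ) * padicNorm p x ^ i ≤ 1 * padicNorm p x ^ i := by
            gcongr
            exact padicNorm.of_int _
        _ ≤ padicNorm p x ^ (g.natDegree - 1) := by
            rw [one_mul]
            have := Finset.mem_range.mp hi
            exact pow_le_pow_right₀ hx1 (by omega)
    · refine hc.trans ?_
      calc padicNorm p x = padicNorm p x ^ 1 := (pow_one _).symm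
        _ ≤ _ := pow_le_pow_right₀ hx1 (by omega)
  have hlt : padicNorm p x ^ (g.natDegree - 1) <
      padicNorm p (g.leadingCoeff : ℚ) * padicNorm p x ^ g.natDegree := by
    have h1 : padicNorm p x ^ g.natDegree =
        padicNorm p x * padicNorm p x ^ (g.natDegree - 1) := by
      rw [← pow_succ']
      congr 1
      omega
    rw [h1, ← mul_assoc]
    exact lt_mul_of_one_lt_left (by positivity) hx
  rw [heval, padicNorm.add_eq_max_of_ne, hlead, max_eq_left (hlow.trans hlt.le)]
  rw [hlead]
  exact (hlow.trans_lt hlt).ne'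

end Padic

lemma gcIter_zero (g : ℤ[X]) (c : ℚ) : gcIter g c 0 = 0 := rfl

lemma gcIter_succ (g : ℤ[X]) (c : ℚ) (n : ℕ) :
    gcIter g c (n + 1) = (g.map (Int.castRingHom ℚ)).eval (gcIter g c n) + c :=
  Function.iterate_succ_apply' _ _ _

lemma gcIter_one {g : ℤ[X]} (h0 : g.coeff 0 = 0) (c : ℚ) : gcIter g c 1 = c := by
  rw [gcIter_succ, gcIter_zero, ← coeff_zero_eq_eval_zero]
  simp [h0]

lemma padicNorm_max_pow_le {p : ℕ} [Fact p.Prime] {g : ℤ[X]} (hg : IsX2Divisible g) (c : ℚ)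
    (n : ℕ) :
    (padicNorm p (g.leadingCoeff : ℚ) * max 1 (padicNorm p (gcIter g c (n + 1)))) ^ g.natDegree ≤
      max 1 (padicNorm p (gcIter g c (n + 2))) := by
  obtain ⟨hd, h0, -⟩ := hg
  set u := padicNorm p (g.leadingCoeff : ℚ) with hu
  have hu0 : 0 ≤ u := padicNorm.nonneg _
  have hu1 : u ≤ 1 := padicNorm.of_int _
  have hinv : u * padicNorm p c ≤ 1 ∨
      ∀ k, padicNorm p c ≤ padicNorm p (gcIter g c (k + 1)) := by
    refine or_iff_not_imp_left.mpr fun hc k => ?_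
    push Not at hc
    induction k with
    | zero => rw [gcIter_one h0]
    | succ k ih =>
      set t := padicNorm p (gcIter g c (k + 1)) with ht
      have hx : 1 < u * t := hc.trans_le (by gcongr)
      have ht1 : 1 ≤ t := by
        have : 0 ≤ t := padicNorm.nonneg _
        nlinarith
      rw [gcIter_succ, padicNorm_eval_add_of_lt hd hx ih, ← hu, ← ht]
      calc padicNorm p c ≤ t := ih
        _ = 1 * t ^ 1 := by ring
        _ ≤ (u * t) * t ^ (g.natDegree - 1) := by
            gcongr
            omega
        _ = u * t ^ g.natDegree := by
            rw [mul_assoc, ← pow_succ']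
            congr 2
            omega
  set t := padicNorm p (gcIter g c (n + 1)) with ht
  have ht0 : 0 ≤ t := padicNorm.nonneg _
  by_cases hx : u * t ≤ 1
  · refine le_max_of_le_left (pow_le_one₀ (by positivity) ?_)
    rw [mul_max_of_nonneg _ _ hu0, mul_one]
    exact max_le hu1 hx
  · push Not at hx
    have ht1 : 1 ≤ t := by nlinarith
    have hct : padicNorm p c ≤ t := by
      rcases hinv with h | h
      · have : 0 < u := by
          rcases hu0.eq_or_lt with h' | h'
          · rw [← h'] at hx; simp at hx; linarith
          · exact h'
        exact le_of_mul_le_mul_left (h.trans hx.le) this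
      · exact h n
    refine le_max_of_le_right ?_
    rw [max_eq_right ht1, gcIter_succ, padicNorm_eval_add_of_lt hd hx hct, ← hu, ← ht, mul_pow]
    gcongr
    exact pow_le_of_le_one hu0 hu1 (by omega)

/-- Denominators grow at least like `d`-th powers, up to a factor depending only on `g`. -/
lemma Bn_pow_le {g : ℤ[X]} (hg : IsX2Divisible g) (c : ℚ) (n : ℕ) :
    Bn g c n ^ g.natDegree ≤ g.leadingCoeff.natAbs ^ g.natDegree * Bn g c (n + 1) := by
  have hu : g.leadingCoeff ≠ 0 := by
    rw [leadingCoeff_ne_zero]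
    rintro rfl
    simpa using hg.1
  refine Nat.le_of_dvd (Nat.mul_pos (pow_pos (Int.natAbs_pos.mpr hu) _) (Rat.den_pos _)) ?_
  rw [Nat.dvd_iff_prime_pow_dvd_dvd]
  intro p k hp hk
  have : Fact p.Prime := ⟨hp⟩
  have key := padicNorm_max_pow_le (p := p) hg c n
  have hB := padicNorm_den_mul_max (p := p) (gcIter g c (n + 1))
  have hB' := padicNorm_den_mul_max (p := p) (gcIter g c (n + 2))
  have hpow : ∀ (x : ℚ) k, padicNorm p (x ^ k) = padicNorm p x ^ k := fun x k => by
    induction k with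
    | zero => simp
    | succ k ih => rw [pow_succ, padicNorm.mul, ih, pow_succ]
  rw [← Int.natCast_dvd_natCast, Nat.cast_pow, ← Nat.cast_pow] at hk ⊢
  rw [padicNorm.dvd_iff_norm_le] at hk ⊢
  refine le_trans ?_ hk
  have e1 : (((g.leadingCoeff.natAbs ^ g.natDegree * Bn g c (n + 1) : ℕ) : ℤ) : ℚ) =
      ((g.leadingCoeff.natAbs : ℤ) : ℚ) ^ g.natDegree * (Bn g c (n + 1) : ℚ) := by push_cast; ring
  have e2 : (((Bn g c n ^ g.natDegree : ℕ) : ℤ) : ℚ) = (Bn g c n : ℚ) ^ g.natDegree := by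
    push_cast; ring
  have e3 : padicNorm p ((g.leadingCoeff.natAbs : ℤ) : ℚ) = padicNorm p (g.leadingCoeff : ℚ) := by
    rcases Int.natAbs_eq g.leadingCoeff with h | h
    · rw [← h]
    · conv_rhs => rw [h]
      rw [Int.cast_neg, padicNorm.neg]
  rw [e1, e2, padicNorm.mul, hpow, hpow, e3]
  unfold Bn
  set u := padicNorm p (g.leadingCoeff : ℚ)
  set s := max 1 (padicNorm p (gcIter g c (n + 1)))
  set s' := max 1 (padicNorm p (gcIter g c (n + 2)))
  set b := padicNorm p ((gcIter g c (n + 1)).den : ℚ)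
  set b' := padicNorm p ((gcIter g c (n + 2)).den : ℚ)
  have hb : 0 ≤ b := padicNorm.nonneg _
  have hb' : 0 ≤ b' := padicNorm.nonneg _
  calc u ^ g.natDegree * b' = (b * s) ^ g.natDegree * (u ^ g.natDegree * b') := by
        rw [hB]; simp
    _ = b ^ g.natDegree * ((u * s) ^ g.natDegree * b') := by ring
    _ ≤ b ^ g.natDegree * (s' * b') := by gcongr
    _ = b ^ g.natDegree := by rw [mul_comm s', hB', mul_one]

lemma exists_eq_int_div_pow {g : ℤ[X]} (hg : IsX2Divisible g) (c : ℚ) (n : ℕ) :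
    ∃ z : ℤ, gcIter g c (n + 1) = z / ((c.den : ℚ) ^ g.natDegree ^ n) := by
  have hb : (c.den : ℚ) ≠ 0 := by simp
  induction n with
  | zero => exact ⟨c.num, by rw [gcIter_one hg.2.1]; simp [Rat.num_div_den]⟩
  | succ n ih =>
    obtain ⟨z, hz⟩ := ih
    set N : ℤ := (c.den : ℤ) ^ g.natDegree ^ n with hN
    have hN0 : (N : ℚ) ≠ 0 := by rw [hN]; push_cast; exact pow_ne_zero _ hb
    obtain ⟨D, bi, h1, h2⟩ := denomsClearable_natDegree (Int.castRingHom ℚ) g z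
      (bi := ((N : ℚ))⁻¹) (b := N) (by simp [inv_mul_cancel₀ hN0])
    have hbi : bi = (N : ℚ)⁻¹ := eq_inv_of_mul_eq_one_left (by simpa using h1)
    have hzN : gcIter g c (n + 1) = z * (N : ℚ)⁻¹ := by
      rw [hz, hN, div_eq_mul_inv]
      push_cast
      rfl
    have hpow : (c.den : ℚ) ^ g.natDegree ^ (n + 1) = (N : ℚ) ^ g.natDegree := by
      rw [hN, pow_succ, pow_mul]
      push_cast
      rfl
    obtain ⟨k, hk⟩ : ∃ k, g.natDegree ^ (n + 1) = k + 1 :=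
      Nat.exists_eq_succ_of_ne_zero (pow_ne_zero _ (by have := hg.1; omega))
    refine ⟨D + c.num * (c.den : ℤ) ^ k, ?_⟩
    simp only [eq_intCast, hbi, ← hzN] at h2
    rw [eq_div_iff (pow_ne_zero _ hb), gcIter_succ, add_mul]
    push_cast
    congr 1
    · rw [h2, hpow, mul_comm]
    · rw [hk, pow_succ', ← mul_assoc, Rat.mul_den_eq_num]

lemma Bn_le {g : ℤ[X]} (hg : IsX2Divisible g) (c : ℚ) (n : ℕ) :
    Bn g c n ≤ c.den ^ g.natDegree ^ n := by
  obtain ⟨z, hz⟩ := exists_eq_int_div_pow hg c n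
  have h : ((gcIter g c (n + 1)).den : ℤ) ∣ ((c.den ^ g.natDegree ^ n : ℕ) : ℤ) := by
    have := Rat.den_dvd z ((c.den ^ g.natDegree ^ n : ℕ) : ℤ)
    rw [Rat.divInt_eq_div] at this
    rw [hz]
    push_cast at this ⊢
    exact this
  exact Nat.le_of_dvd (pow_pos c.den_pos _) (Int.natCast_dvd_natCast.mp h)

lemma abs_eval_le_mul_max_pow (P : ℝ[X]) :
    ∃ S : ℝ, 1 ≤ S ∧ ∀ (x : ℝ) (k : ℕ), P.natDegree ≤ k → |P.eval x| ≤ S * max 1 |x| ^ k := by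
  refine ⟨1 + ∑ i ∈ Finset.range (P.natDegree + 1), |P.coeff i|, ?_, fun x k hk => ?_⟩
  · have : 0 ≤ ∑ i ∈ Finset.range (P.natDegree + 1), |P.coeff i| := by positivity
    linarith
  · have h1 : (1 : ℝ) ≤ max 1 |x| := le_max_left _ _
    rw [eval_eq_sum_range]
    calc |∑ i ∈ Finset.range (P.natDegree + 1), P.coeff i * x ^ i|
        ≤ ∑ i ∈ Finset.range (P.natDegree + 1), |P.coeff i * x ^ i| :=
          Finset.abs_sum_le_sum_abs _ _
      _ ≤ ∑ i ∈ Finset.range (P.natDegree + 1), |P.coeff i| * max 1 |x| ^ k := by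
          refine Finset.sum_le_sum fun i hi => ?_
          rw [abs_mul, abs_pow]
          have := Finset.mem_range.mp hi
          gcongr
          calc |x| ^ i ≤ max 1 |x| ^ i := by gcongr; exact le_max_right _ _
            _ ≤ max 1 |x| ^ k := pow_le_pow_right₀ h1 (by omega)
      _ ≤ _ := by
          rw [← Finset.sum_mul]
          gcongr
          linarith

/-- Far from the origin, a polynomial with leading coefficient at least one in absolute value
has at least half the size of the corresponding monomial. -/
lemma exists_le_abs_eval (P : ℝ[X]) (hd : 1 ≤ P.natDegree) (hu : 1 ≤ |P.leadingCoeff|) :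
    ∃ R : ℝ, 4 ≤ R ∧ ∀ x : ℝ, R ≤ |x| → |x| ^ P.natDegree / 2 ≤ |P.eval x| := by
  obtain ⟨S, hS, hle⟩ := abs_eval_le_mul_max_pow P.eraseLead
  refine ⟨4 * S, by linarith, fun x hx => ?_⟩
  have h1 : 1 ≤ |x| := by linarith
  have h2 := hle x (P.natDegree - 1) (eraseLead_natDegree_le P)
  rw [max_eq_right h1] at h2
  have h3 : P.eval x = P.eraseLead.eval x + P.leadingCoeff * x ^ P.natDegree := by
    have := congrArg (eval x) P.eraseLead_add_C_mul_X_pow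
    rw [eval_add, eval_mul, eval_C, eval_pow, eval_X] at this
    exact this.symm
  have h4 : |x| ^ P.natDegree = |x| * |x| ^ (P.natDegree - 1) := by
    rw [← pow_succ']
    congr 1
    omega
  have h5 : |x| ^ P.natDegree ≤ |P.leadingCoeff * x ^ P.natDegree| := by
    rw [abs_mul, abs_pow]
    exact le_mul_of_one_le_left (by positivity) hu
  have h6 : |P.leadingCoeff * x ^ P.natDegree| ≤ |P.eval x| + |P.eraseLead.eval x| := by
    have : P.leadingCoeff * x ^ P.natDegree = P.eval x - P.eraseLead.eval x := by rw [h3]; ring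
    rw [this]
    exact abs_sub _ _
  have h7 : 4 * (S * |x| ^ (P.natDegree - 1)) ≤ |x| ^ P.natDegree := by
    rw [h4, ← mul_assoc]
    gcongr
  have h8 : 0 ≤ |x| ^ P.natDegree := by positivity
  linarith

lemma exists_abs_eval_sub_le (P : ℝ[X]) (ρ : ℝ) :
    ∃ L : ℝ, 1 ≤ L ∧ ∀ x y : ℝ, |x| ≤ ρ → |y| ≤ ρ → |P.eval x - P.eval y| ≤ L * |x - y| := by
  obtain ⟨C, hC⟩ := (isCompact_Icc (a := -ρ) (b := ρ)).exists_bound_of_continuousOn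
    (f := fun x => P.derivative.eval x) P.derivative.continuous.continuousOn
  refine ⟨max 1 C, le_max_left _ _, fun x y hx hy => ?_⟩
  have := (convex_Icc (-ρ) ρ).norm_image_sub_le_of_norm_deriv_le (f := fun x => P.eval x)
    (C := max 1 C) (fun x _ => P.differentiableAt)
    (fun x hx => by rw [Polynomial.deriv]; exact (hC x hx).trans (le_max_right _ _))
    (abs_le.mp hy) (abs_le.mp hx)
  simpa [Real.norm_eq_abs] using this

lemma exists_abs_eval_le_mul_sq (P : ℝ[X]) (h0 : P.coeff 0 = 0) (h1 : P.coeff 1 = 0) (ρ : ℝ) :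
    ∃ M : ℝ, 1 ≤ M ∧ ∀ x : ℝ, |x| ≤ ρ → |P.eval x| ≤ M * x ^ 2 := by
  obtain ⟨Q, hQ⟩ : X ^ 2 ∣ P := by
    rw [X_pow_dvd_iff]
    intro i hi
    interval_cases i <;> assumption
  obtain ⟨C, hC⟩ := (isCompact_Icc (a := -ρ) (b := ρ)).exists_bound_of_continuousOn
    (f := fun x => Q.eval x) Q.continuous.continuousOn
  refine ⟨max 1 C, le_max_left _ _, fun x hx => ?_⟩
  rw [hQ, eval_mul, eval_pow, eval_X, abs_mul, abs_of_nonneg (sq_nonneg x), mul_comm]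
  gcongr
  exact (hC x (abs_le.mp hx)).trans (le_max_right _ _)

/-- If the orbit of the critical point `0` returns very close to `0` at time `n + 1`, then
it later remains close either to the point of return or to an earlier point of the orbit. -/
lemma iterate_near_return {f : ℝ → ℝ} {ρ L M : ℝ} (hL : 1 ≤ L) (hM : 1 ≤ M)
    (hlip : ∀ x y : ℝ, |x| ≤ ρ + 1 → |y| ≤ ρ + 1 → |f x - f y| ≤ L * |x - y|)
    (hsq : ∀ x : ℝ, |x| ≤ ρ + 1 → |f x - f 0| ≤ M * x ^ 2) {n : ℕ}
    (hρ : ∀ j ≤ n + 1, |f^[j] 0| ≤ ρ) (hδ : 8 * M * L ^ n * |f^[n + 1] 0| ≤ 1)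
    {k : ℕ} (hk : n < k) :
    |f^[n + 1] 0| / 2 ≤ |f^[k + 1] 0| ∨
      ∃ j < n, |f^[k + 1] 0 - f^[j + 1] 0| ≤ 4 * M * L ^ n * (f^[n + 1] 0) ^ 2 := by
  set δ := f^[n + 1] 0 with hδdef
  have hLn : 1 ≤ L ^ n := one_le_pow₀ hL
  have hML : 1 ≤ M * L ^ n := one_le_mul_of_one_le_of_one_le hM hLn
  have hδ0 := abs_nonneg δ
  have hδ8 : 8 * |δ| ≤ 1 := by nlinarith
  have hρ0 : 0 ≤ ρ := (abs_nonneg _).trans (hρ 0 (by omega))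
  have hsqδ : 4 * M * L ^ n * δ ^ 2 ≤ |δ| / 2 := by
    rw [← sq_abs]
    nlinarith
  have hstep : ∀ z : ℝ, |z| ≤ 2 * |δ| → ∀ j ≤ n,
      |f^[j + 1] z - f^[j + 1] 0| ≤ 4 * M * L ^ j * δ ^ 2 := by
    intro z hz j
    have hz2 : z ^ 2 ≤ 4 * δ ^ 2 := by
      rw [← sq_abs, ← sq_abs δ]
      nlinarith [abs_nonneg z]
    induction j with
    | zero =>
      intro _
      calc _ ≤ M * z ^ 2 := hsq z (by linarith)
        _ ≤ M * (4 * δ ^ 2) := by gcongr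
        _ = _ := by ring
    | succ j ih =>
      intro hj
      have hprev := ih (by omega)
      have hle : 4 * M * L ^ j * δ ^ 2 ≤ 4 * M * L ^ n * δ ^ 2 := by
        gcongr
        omega
      have h0 := hρ (j + 1) (by omega)
      have h1 : |f^[j + 1] z| ≤ ρ + 1 := by
        have := abs_sub_abs_le_abs_sub (f^[j + 1] z) (f^[j + 1] 0)
        linarith
      rw [Function.iterate_succ_apply' f (j + 1), Function.iterate_succ_apply' f (j + 1)]
      calc _ ≤ L * |f^[j + 1] z - f^[j + 1] 0| := hlip _ _ h1 (by linarith)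
        _ ≤ L * (4 * M * L ^ j * δ ^ 2) := by gcongr
        _ = _ := by ring
  have hret : ∀ q : ℕ, |f^[(n + 1) * (q + 1)] 0 - δ| ≤ |δ| / 2 := by
    intro q
    induction q with
    | zero => simp only [zero_add, mul_one, ← hδdef, sub_self, abs_zero]; positivity
    | succ q ih =>
      have hz : |f^[(n + 1) * (q + 1)] 0| ≤ 2 * |δ| := by
        have := abs_sub_abs_le_abs_sub (f^[(n + 1) * (q + 1)] 0) δ
        linarith
      have := hstep _ hz n le_rfl
      rw [← Function.iterate_add_apply, ← hδdef,
        show n + 1 + (n + 1) * (q + 1) = (n + 1) * (q + 1 + 1) by ring] at this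
      linarith
  obtain ⟨q, hq⟩ : ∃ q, (k + 1) / (n + 1) = q + 1 :=
    ⟨(k + 1) / (n + 1) - 1, by
      have : 0 < (k + 1) / (n + 1) := Nat.div_pos (by omega) (by omega)
      omega⟩
  have hdiv := Nat.div_add_mod (k + 1) (n + 1)
  rw [hq] at hdiv
  have hmod := Nat.mod_lt (k + 1) (Nat.succ_pos n)
  have hz : |f^[(n + 1) * (q + 1)] 0| ≤ 2 * |δ| := by
    have := abs_sub_abs_le_abs_sub (f^[(n + 1) * (q + 1)] 0) δ
    linarith [hret q]
  rcases hr : (k + 1) % (n + 1) with _ | j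
  · left
    rw [hr, add_zero] at hdiv
    rw [← hdiv]
    have := abs_sub_abs_le_abs_sub δ (f^[(n + 1) * (q + 1)] 0)
    rw [abs_sub_comm] at this
    linarith [hret q]
  · right
    rw [hr] at hdiv hmod
    refine ⟨j, by omega, ?_⟩
    have := hstep _ hz j (by omega)
    rw [← Function.iterate_add_apply, show j + 1 + (n + 1) * (q + 1) = k + 1 by omega] at this
    refine this.trans ?_
    gcongr
    omega

open Filter in
lemma eventually_sum_primeFactors_le {d : ℕ} (hd : 2 ≤ d) {η : ℝ} (hη : 0 < η) :
    ∀ᶠ n : ℕ in atTop, ∀ (α : ℕ → ℝ) (Y : ℝ), 0 < Y → (∀ k, α k ≤ Y * d ^ k) →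
      ∑ p ∈ n.primeFactors, α (n / p) ≤ η * (Y * d ^ n) := by
  have hd1 : (1 : ℝ) < d := by exact_mod_cast hd
  have hlim : Tendsto (fun k : ℕ => (k : ℝ) ^ 1 / (d : ℝ) ^ k) atTop (nhds 0) :=
    tendsto_pow_const_div_const_pow_of_one_lt 1 hd1
  have hev := ((hlim.eventually_le_const (show (0 : ℝ) < η / 3 by positivity)).and
    (eventually_ge_atTop 1)).filter_mono (Nat.tendsto_div_const_atTop (n := 2) (by norm_num))
  rw [eventually_map] at hev
  filter_upwards [hev] with n hn α Y hY hα
  obtain ⟨hn, hn1⟩ := hn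
  rw [pow_one, div_le_iff₀ (by positivity)] at hn
  have hn3 : (n : ℝ) ≤ 3 * ((n / 2 : ℕ) : ℝ) := by exact_mod_cast (by omega : n ≤ 3 * (n / 2))
  have hcard : (n.primeFactors.card : ℝ) ≤ n := by
    have h : n.primeFactors ⊆ Finset.Icc 1 n := fun p hp => by
      rw [Finset.mem_Icc]
      exact ⟨(Nat.prime_of_mem_primeFactors hp).one_le, Nat.le_of_mem_primeFactors hp⟩
    exact_mod_cast (by simpa using Finset.card_le_card h)
  calc ∑ p ∈ n.primeFactors, α (n / p) ≤ ∑ p ∈ n.primeFactors, Y * (d : ℝ) ^ (n / 2) := by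
        refine Finset.sum_le_sum fun p hp => (hα _).trans ?_
        gcongr
        · exact hd1.le
        · exact (Nat.prime_of_mem_primeFactors hp).two_le
    _ = n.primeFactors.card * (Y * (d : ℝ) ^ (n / 2)) := by rw [Finset.sum_const, nsmul_eq_mul]
    _ ≤ (η * (d : ℝ) ^ (n / 2)) * (Y * (d : ℝ) ^ (n / 2)) := by
        gcongr
        linarith
    _ = η * (Y * (d : ℝ) ^ (n / 2 + n / 2)) := by ring
    _ ≤ η * (Y * (d : ℝ) ^ n) := by
        gcongr
        · exact hd1.le
        · omega

lemma Rat.finite_setOf_den_le_abs_le (Q : ℕ) (R : ℝ) :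
    {x : ℚ | x.den ≤ Q ∧ |(x : ℝ)| ≤ R}.Finite := by
  set K : ℤ := ⌈R * Q⌉
  refine Set.Finite.of_finite_image (f := fun x : ℚ => (x.num, x.den))
    (((Set.finite_Icc (-K) K).prod (Set.finite_Iic Q)).subset ?_)
    (fun x _ y _ h => Rat.ext (congrArg Prod.fst h) (congrArg Prod.snd h))
  rintro _ ⟨x, ⟨hx, hR⟩, rfl⟩
  refine ⟨?_, hx⟩
  have hR0 : 0 ≤ R := (abs_nonneg _).trans hR
  have hnum : |(x.num : ℝ)| ≤ R * Q := by
    have : (x.num : ℝ) = x * x.den := by exact_mod_cast (Rat.mul_den_eq_num x).symm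
    rw [this, abs_mul, Nat.abs_cast]
    gcongr
  have : ((|x.num| : ℤ) : ℝ) ≤ (K : ℝ) := by
    rw [Int.cast_abs]
    exact hnum.trans (Int.le_ceil _)
  exact abs_le.mp (by exact_mod_cast this)

lemma natDegree_map_real (g : ℤ[X]) : (g.map (Int.castRingHom ℝ)).natDegree = g.natDegree :=
  natDegree_map_eq_of_injective (RingHom.injective_int _) g

lemma leadingCoeff_ne_zero_of_isX2Divisible {g : ℤ[X]} (hg : IsX2Divisible g) :
    g.leadingCoeff ≠ 0 := by
  rw [leadingCoeff_ne_zero]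
  rintro rfl
  simpa using hg.1

lemma one_le_abs_leadingCoeff_map {g : ℤ[X]} (hg : IsX2Divisible g) :
    1 ≤ |(g.map (Int.castRingHom ℝ)).leadingCoeff| := by
  rw [leadingCoeff_map_of_injective (RingHom.injective_int _), eq_intCast, ← Int.cast_abs]
  exact_mod_cast Int.one_le_abs (leadingCoeff_ne_zero_of_isX2Divisible hg)

lemma gcIter_succ_real (g : ℤ[X]) (c : ℚ) (n : ℕ) :
    (gcIter g c (n + 1) : ℝ) = (g.map (Int.castRingHom ℝ)).eval (gcIter g c n : ℝ) + c := by
  rw [gcIter_succ]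
  push_cast
  congr 1
  simp [eval_map, eval₂_eq_sum_range]

lemma gcIter_real (g : ℤ[X]) (c : ℚ) (n : ℕ) :
    (gcIter g c n : ℝ) = (fun x : ℝ => (g.map (Int.castRingHom ℝ)).eval x + c)^[n] 0 := by
  induction n with
  | zero => simp [gcIter_zero]
  | succ n ih => rw [gcIter_succ_real, Function.iterate_succ_apply', ih]

lemma gcIter_ne_zero {g : ℤ[X]} {c : ℚ} (hc : c ∈ Sg g) (n : ℕ) : gcIter g c (n + 1) ≠ 0 := by
  intro h
  refine hc (((Set.finite_Iio (n + 1)).image (gcIter g c)).subset ?_)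
  rintro _ ⟨k, rfl⟩
  have hper : Function.IsPeriodicPt
      (fun x : ℚ => (g.map (Int.castRingHom ℚ)).eval x + c) (n + 1) 0 := h
  exact ⟨(k + 1) % (n + 1), Nat.mod_lt _ n.succ_pos, hper.iterate_mod_apply (k + 1)⟩

lemma log_Bn_nonneg (g : ℤ[X]) (c : ℚ) (n : ℕ) : 0 ≤ Real.log (Bn g c n) :=
  Real.log_natCast_nonneg _

lemma log_Bn_zero {g : ℤ[X]} (hg : IsX2Divisible g) (c : ℚ) :
    Real.log (Bn g c 0) = Real.log c.den := by
  rw [Bn, gcIter_one hg.2.1]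

lemma log_Bn_succ {g : ℤ[X]} (hg : IsX2Divisible g) (c : ℚ) (n : ℕ) :
    g.natDegree * Real.log (Bn g c n) ≤
      g.natDegree * Real.log g.leadingCoeff.natAbs + Real.log (Bn g c (n + 1)) := by
  have h : (Bn g c n : ℝ) ^ g.natDegree ≤
      (g.leadingCoeff.natAbs : ℝ) ^ g.natDegree * Bn g c (n + 1) := by
    exact_mod_cast Bn_pow_le hg c n
  have h1 : (0 : ℝ) < Bn g c n := by exact_mod_cast Rat.den_pos _
  have h2 : (0 : ℝ) < Bn g c (n + 1) := by exact_mod_cast Rat.den_pos _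
  have h3 : (0 : ℝ) < g.leadingCoeff.natAbs := by
    exact_mod_cast Int.natAbs_pos.mpr (leadingCoeff_ne_zero_of_isX2Divisible hg)
  have := Real.log_le_log (by positivity) h
  rwa [Real.log_mul (by positivity) h2.ne', Real.log_pow, Real.log_pow] at this

lemma log_Bn_le {g : ℤ[X]} (hg : IsX2Divisible g) (c : ℚ) (n : ℕ) :
    Real.log (Bn g c n) ≤ Real.log c.den * g.natDegree ^ n := by
  have h : (Bn g c n : ℝ) ≤ (c.den : ℝ) ^ g.natDegree ^ n := by exact_mod_cast Bn_le hg c n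
  have h1 : (0 : ℝ) < Bn g c n := by exact_mod_cast Rat.den_pos _
  have := Real.log_le_log h1 h
  rw [Real.log_pow] at this
  push_cast at this
  linarith

lemma log_abs_An {g : ℤ[X]} {c : ℚ} (hc : c ∈ Sg g) (n : ℕ) :
    Real.log |(An g c n : ℝ)| = Real.log |(gcIter g c (n + 1) : ℝ)| + Real.log (Bn g c n) := by
  have h0 : (gcIter g c (n + 1) : ℝ) ≠ 0 := by exact_mod_cast gcIter_ne_zero hc n
  have h1 : (Bn g c n : ℝ) ≠ 0 := by exact_mod_cast Rat.den_nz _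
  have h : (An g c n : ℝ) = gcIter g c (n + 1) * Bn g c n := by
    unfold An Bn
    exact_mod_cast (Rat.mul_den_eq_num _).symm
  rw [h, abs_mul, Nat.abs_cast, Real.log_mul (abs_ne_zero.mpr h0) h1]

lemma neg_log_Bn_le {g : ℤ[X]} {c : ℚ} (hc : c ∈ Sg g) (n : ℕ) :
    -Real.log (Bn g c n) ≤ Real.log |(gcIter g c (n + 1) : ℝ)| := by
  have h := log_abs_An hc n
  have : 0 ≤ Real.log |(An g c n : ℝ)| := by
    rw [← Int.cast_abs]
    refine Real.log_nonneg ?_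
    exact_mod_cast Int.one_le_abs (Rat.num_ne_zero.mpr (gcIter_ne_zero hc n))
  linarith

/-- An upper bound for the canonical height of the critical orbit of `g + c`, where `κ` is a
constant depending only on `g`. -/
noncomputable def heightBound (κ : ℝ) (c : ℚ) : ℝ :=
  2 * (κ + Real.log (max 1 |(c : ℝ)|)) + Real.log c.den

lemma two_mul_le_heightBound (κ : ℝ) (c : ℚ) : 2 * κ ≤ heightBound κ c := by
  have h1 : 0 ≤ Real.log (max 1 |(c : ℝ)|) := Real.log_nonneg (le_max_left _ _)
  have h2 : 0 ≤ Real.log (c.den : ℝ) := Real.log_natCast_nonneg _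
  unfold heightBound
  linarith

lemma heightBound_pos {κ : ℝ} (hκ : 0 < κ) (c : ℚ) : 0 < heightBound κ c := by
  linarith [two_mul_le_heightBound κ c]

lemma exists_log_abs_An_le {g : ℤ[X]} (hg : IsX2Divisible g) :
    ∃ κ : ℝ, 0 < κ ∧ ∀ c ∈ Sg g, ∀ n,
      Real.log |(An g c n : ℝ)| ≤ heightBound κ c * g.natDegree ^ n := by
  obtain ⟨S, hS, hle⟩ := abs_eval_le_mul_max_pow (g.map (Int.castRingHom ℝ))
  refine ⟨Real.log (S + 1), Real.log_pos (by linarith), fun c hc n => ?_⟩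
  set p := Real.log (S + 1) + Real.log (max 1 |(c : ℝ)|) with hp
  have hd : (2 : ℝ) ≤ g.natDegree := by exact_mod_cast hg.1
  have hC : (1 : ℝ) ≤ max 1 |(c : ℝ)| := le_max_left _ _
  have hp0 : 0 ≤ p := add_nonneg (Real.log_nonneg (by linarith)) (Real.log_nonneg hC)
  have hstep : ∀ k, Real.log (max 1 |(gcIter g c (k + 2) : ℝ)|) ≤
      p + g.natDegree * Real.log (max 1 |(gcIter g c (k + 1) : ℝ)|) := by
    intro k
    set t := max 1 |(gcIter g c (k + 1) : ℝ)| with ht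
    have ht1 : 1 ≤ t := le_max_left _ _
    have ht2 : 1 ≤ t ^ g.natDegree := one_le_pow₀ ht1
    have hb : max 1 |(gcIter g c (k + 2) : ℝ)| ≤
        (S + 1) * max 1 |(c : ℝ)| * t ^ g.natDegree := by
      have h1 := hle (gcIter g c (k + 1)) g.natDegree (natDegree_map_real g).le
      have h2 : |(gcIter g c (k + 2) : ℝ)| ≤ S * t ^ g.natDegree + max 1 |(c : ℝ)| := by
        rw [gcIter_succ_real]
        exact (abs_add_le _ _).trans (add_le_add h1 (le_max_right _ _))
      have h3 : max 1 |(c : ℝ)| ≤ max 1 |(c : ℝ)| * t ^ g.natDegree :=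
        le_mul_of_one_le_right (by linarith) ht2
      have h4 : S * t ^ g.natDegree ≤ S * t ^ g.natDegree * max 1 |(c : ℝ)| :=
        le_mul_of_one_le_right (by positivity) hC
      have h5 : 0 ≤ S * t ^ g.natDegree := by positivity
      refine max_le ?_ ?_ <;> linarith
    have := Real.log_le_log (by positivity) hb
    rwa [Real.log_mul (by positivity) (by positivity), Real.log_mul (by positivity) (by positivity),
      Real.log_pow] at this
  have hbound : ∀ k, Real.log (max 1 |(gcIter g c (k + 1) : ℝ)|) ≤
      p * (2 * g.natDegree ^ k - 1) := by
    intro k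
    induction k with
    | zero =>
      rw [gcIter_one hg.2.1, hp]
      have : 0 ≤ Real.log (S + 1) := Real.log_nonneg (by linarith)
      linarith
    | succ k ih =>
      have h1 : (g.natDegree : ℝ) * Real.log (max 1 |(gcIter g c (k + 1) : ℝ)|) ≤
          g.natDegree * (p * (2 * g.natDegree ^ k - 1)) := by gcongr
      have h2 := hstep k
      have h3 : p * 2 ≤ p * g.natDegree := by gcongr
      rw [pow_succ]
      linarith
  have h0 : (gcIter g c (n + 1) : ℝ) ≠ 0 := by exact_mod_cast gcIter_ne_zero hc n
  have h1 : Real.log |(gcIter g c (n + 1) : ℝ)| ≤ Real.log (max 1 |(gcIter g c (n + 1) : ℝ)|) :=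
    Real.log_le_log (abs_pos.mpr h0) (le_max_right _ _)
  have h2 := hbound n
  have h3 := log_Bn_le hg c n
  rw [log_abs_An hc, heightBound, ← hp, add_mul]
  linarith

/-- Outside a large disc containing `c`, the orbit escapes to infinity. -/
lemma exists_escape {g : ℤ[X]} (hg : IsX2Divisible g) (hd : 3 ≤ g.natDegree) :
    ∃ R : ℝ, 4 ≤ R ∧ ∀ (c : ℚ) (m : ℕ), max R |(c : ℝ)| ≤ |(gcIter g c m : ℝ)| →
      ∀ n, m ≤ n → max R |(c : ℝ)| ≤ |(gcIter g c n : ℝ)| ∧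
        4 * |(gcIter g c n : ℝ)| ≤ |(gcIter g c (n + 1) : ℝ)| ∧
        |(gcIter g c n : ℝ)| ^ g.natDegree ≤ 4 * |(gcIter g c (n + 1) : ℝ)| := by
  obtain ⟨R, hR, hle⟩ := exists_le_abs_eval (g.map (Int.castRingHom ℝ))
    (by rw [natDegree_map_real]; omega) (one_le_abs_leadingCoeff_map hg)
  rw [natDegree_map_real] at hle
  refine ⟨R, hR, fun c m hm n hn => ?_⟩
  have hstep : ∀ k, max R |(c : ℝ)| ≤ |(gcIter g c k : ℝ)| →
      4 * |(gcIter g c k : ℝ)| ≤ |(gcIter g c (k + 1) : ℝ)| ∧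
        |(gcIter g c k : ℝ)| ^ g.natDegree ≤ 4 * |(gcIter g c (k + 1) : ℝ)| := by
    intro k hk
    have hRk := (le_max_left _ _).trans hk
    have hck := (le_max_right _ _).trans hk
    have h1 := hle _ hRk
    have h2 : |(g.map (Int.castRingHom ℝ)).eval (gcIter g c k : ℝ)| ≤
        |(gcIter g c (k + 1) : ℝ)| + |(c : ℝ)| := by
      have : (g.map (Int.castRingHom ℝ)).eval (gcIter g c k : ℝ) = gcIter g c (k + 1) - c := by
        rw [gcIter_succ_real]; ring
      rw [this]
      exact abs_sub _ _
    set t := |(gcIter g c k : ℝ)|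
    have h3 : 16 * t ≤ t ^ g.natDegree := by
      calc 16 * t ≤ t ^ 3 := by nlinarith [mul_self_nonneg t]
        _ ≤ t ^ g.natDegree := pow_le_pow_right₀ (by linarith) hd
    constructor <;> linarith
  have hall : max R |(c : ℝ)| ≤ |(gcIter g c n : ℝ)| := by
    induction n, hn using Nat.le_induction with
    | base => exact hm
    | succ k _ ih => linarith [(hstep k ih).1, abs_nonneg (gcIter g c k : ℝ)]
  exact ⟨hall, hstep n hall⟩

lemma geometric_growth {a : ℕ → ℝ} {d : ℕ} (hd : 3 ≤ d) {K : ℝ} (hK : 0 ≤ K) {m : ℕ}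
    (h : ∀ n, m ≤ n → d * a n ≤ K + a (n + 1)) (ha : K ≤ a m) {n : ℕ} (hn : m ≤ n) :
    a m / (2 * d ^ m) * d ^ n ≤ a n := by
  have hd' : (3 : ℝ) ≤ d := by exact_mod_cast hd
  have key : (a m - K / 2) * d ^ (n - m) ≤ a n - K / 2 := by
    induction n, hn using Nat.le_induction with
    | base => simp
    | succ k hk ih =>
      have h1 := h k hk
      have h2 : (d : ℝ) * ((a m - K / 2) * d ^ (k - m)) ≤ d * (a k - K / 2) := by gcongr
      rw [show k + 1 - m = k - m + 1 by omega, pow_succ]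
      nlinarith
  have h1 : a m / (2 * d ^ m) * d ^ n = a m / 2 * (d : ℝ) ^ (n - m) := by
    obtain ⟨k, rfl⟩ := Nat.exists_eq_add_of_le hn
    rw [Nat.add_sub_cancel_left, pow_add]
    field_simp
  have h2 : a m / 2 * (d : ℝ) ^ (n - m) ≤ (a m - K / 2) * d ^ (n - m) := by
    gcongr
    linarith
  linarith

open Filter in
lemma eventually_add_mul_le_mul_pow {d : ℝ} (hd : 1 < d) (C D : ℝ) {ε : ℝ} (hε : 0 < ε) :
    ∀ᶠ n : ℕ in atTop, C + n * D ≤ ε * d ^ n := by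
  have h0 := (tendsto_pow_const_div_const_pow_of_one_lt 0 hd).const_mul C
  have h1 := (tendsto_pow_const_div_const_pow_of_one_lt 1 hd).const_mul D
  have h := h0.add h1
  rw [mul_zero, mul_zero, add_zero] at h
  filter_upwards [h.eventually_le_const hε] with n hn
  have hpos : 0 < d ^ n := by positivity
  have : C * ((n : ℝ) ^ 0 / d ^ n) + D * ((n : ℝ) ^ 1 / d ^ n) = (C + n * D) / d ^ n := by
    field_simp
  rwa [this, div_le_iff₀ hpos] at hn

lemma le_max_of_mul_le_add {y : ℕ → ℝ} {d w : ℝ} (hd : 2 ≤ d) (hy : ∀ n, 0 ≤ y n)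
    (h : ∀ n, d * y n ≤ w + y (n + 1)) {j n : ℕ} (hj : j ≤ n) : y j ≤ max (y n) w := by
  induction n, hj using Nat.le_induction with
  | base => exact le_max_left _ _
  | succ k _ ih =>
    rw [le_max_iff] at ih ⊢
    rcases ih with ih | ih
    · by_contra! hlt
      nlinarith [h k, hy k]
    · exact Or.inr ih

/-- The inequality defining rapidly increasing numerators, at the index `n`. -/
def NumeratorDominates (g : ℤ[X]) (c : ℚ) (n : ℕ) : Prop :=
  ∑ p ∈ n.primeFactors, Real.log |(An g c (n / p) : ℝ)| < Real.log |(An g c n : ℝ)|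

lemma exists_numeratorDominates {g : ℤ[X]} (hg : IsX2Divisible g) {κ : ℝ} (hκ0 : 0 < κ)
    (hκ : ∀ c ∈ Sg g, ∀ n, Real.log |(An g c n : ℝ)| ≤ heightBound κ c * g.natDegree ^ n)
    {θ : ℝ} (hθ : 0 < θ) (m : ℕ) :
    ∃ N : ℕ, ∀ c ∈ Sg g,
      (∀ n, m ≤ n → θ * (heightBound κ c * g.natDegree ^ n) ≤ Real.log |(An g c n : ℝ)|) →
      ∀ n, N ≤ n → NumeratorDominates g c n := by
  obtain ⟨N, hN⟩ := Filter.eventually_atTop.mp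
    (eventually_sum_primeFactors_le hg.1 (half_pos hθ))
  refine ⟨max N m, fun c hc hlow n hn => ?_⟩
  have hY := heightBound_pos hκ0 c
  have h1 := hN n (le_of_max_le_left hn) _ _ hY (hκ c hc)
  have h2 := hlow n (le_of_max_le_right hn)
  have hd : (0 : ℝ) < g.natDegree := by exact_mod_cast (by have := hg.1; omega)
  have h3 : 0 < θ * (heightBound κ c * g.natDegree ^ n) := by positivity
  unfold NumeratorDominates
  linarith

/-- If the denominators grow as fast as the height and `c` is bounded, then beyond a uniform
index there is at most one exception. -/
lemma exists_unique_exception {g : ℤ[X]} (hg : IsX2Divisible g) (hd : 3 ≤ g.natDegree)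
    {κ : ℝ} (hκ0 : 0 < κ)
    (hκ : ∀ c ∈ Sg g, ∀ n, Real.log |(An g c n : ℝ)| ≤ heightBound κ c * g.natDegree ^ n)
    (R : ℝ) {θ : ℝ} (hθ : 0 < θ) (m : ℕ) :
    ∃ N : ℕ, ∀ c ∈ Sg g, |(c : ℝ)| ≤ R →
      (∀ n, m ≤ n → θ * (heightBound κ c * g.natDegree ^ n) ≤ Real.log (Bn g c n)) →
      ∀ n, N ≤ n → ∀ k, n < k → ¬ NumeratorDominates g c n → NumeratorDominates g c k := by
  obtain ⟨R₀, hR₀, hesc⟩ := exists_escape hg hd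
  set P := g.map (Int.castRingHom ℝ) with hP
  obtain ⟨L, hL, hlip⟩ := exists_abs_eval_sub_le P (max R₀ R + 1)
  obtain ⟨M, hM, hsq⟩ := exists_abs_eval_le_mul_sq P (by simp [hP, hg.2.1]) (by simp [hP, hg.2.2])
    (max R₀ R + 1)
  have hd' : (3 : ℝ) ≤ g.natDegree := by exact_mod_cast hd
  set w := g.natDegree * Real.log g.leadingCoeff.natAbs with hw
  have hw0 : 0 ≤ w := mul_nonneg (by positivity) (Real.log_natCast_nonneg _)
  obtain ⟨N, hN⟩ := Filter.eventually_atTop.mp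
    ((eventually_sum_primeFactors_le hg.1 (show 0 < θ / 4 by positivity)).and
      (eventually_add_mul_le_mul_pow (d := (g.natDegree : ℝ)) (by linarith)
        (2 * Real.log (8 * M) + 2 * w + 2) (2 * Real.log L) (show 0 < θ * (2 * κ) by positivity)))
  refine ⟨max N m, fun c hc hcR hlow n hn k hnk hbad => ?_⟩
  by_contra hbad'
  have hY := heightBound_pos hκ0 c
  have hlogL : 0 ≤ Real.log L := Real.log_nonneg hL
  have hlogM : 0 ≤ Real.log (8 * M) := Real.log_nonneg (by linarith)
  have hx0 : ∀ i, 0 < |(gcIter g c (i + 1) : ℝ)| := fun i =>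
    abs_pos.mpr (by exact_mod_cast gcIter_ne_zero hc i)
  have hsmall : ∀ i, max N m ≤ i → ¬ NumeratorDominates g c i →
      Real.log |(gcIter g c (i + 1) : ℝ)| ≤ -(3 / 4) * Real.log (Bn g c i) := by
    intro i hi hbadi
    have h1 := (hN i (le_of_max_le_left hi)).1 _ _ hY (hκ c hc)
    have h2 := hlow i (le_of_max_le_right hi)
    have h3 := log_abs_An hc i
    unfold NumeratorDominates at hbadi
    push Not at hbadi
    linarith
  have hsn := hsmall n hn hbad
  have hsk := hsmall k (hn.trans hnk.le) hbad'
  set y := fun i => Real.log (Bn g c i) with hy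
  have hrec : ∀ i, g.natDegree * y i ≤ w + y (i + 1) := log_Bn_succ hg c
  have hy0 : ∀ i, 0 ≤ y i := log_Bn_nonneg g c
  change Real.log |(gcIter g c (n + 1) : ℝ)| ≤ -(3 / 4) * y n at hsn
  change Real.log |(gcIter g c (k + 1) : ℝ)| ≤ -(3 / 4) * y k at hsk
  have hyn : 2 * Real.log (8 * M) + 2 * w + 2 + n * (2 * Real.log L) ≤ y n := by
    refine ((hN n (le_of_max_le_left hn)).2).trans (le_trans ?_ (hlow n (le_of_max_le_right hn)))
    rw [mul_assoc]
    gcongr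
    exact two_mul_le_heightBound κ c
  have hnL : 0 ≤ n * Real.log L := by positivity
  have hyk : 3 * y n - w ≤ y k := by
    have h1 := hrec n
    have h2 : 3 * y n ≤ g.natDegree * y n := by gcongr
    rcases le_max_iff.mp (le_max_of_mul_le_add (by linarith) hy0 hrec hnk) with h | h <;>
      simp only [Nat.succ_eq_add_one] at h <;> linarith
  have hlow_k : -(y n + 1) ≤ Real.log |(gcIter g c (k + 1) : ℝ)| := by
    have hlog2 : Real.log 2 ≤ 1 := by linarith [Real.log_two_lt_d9]
    have hhalf : ∀ i, -y n ≤ Real.log |(gcIter g c (i + 1) : ℝ)| →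
        |(gcIter g c (i + 1) : ℝ)| / 2 ≤ |(gcIter g c (k + 1) : ℝ)| →
        -(y n + 1) ≤ Real.log |(gcIter g c (k + 1) : ℝ)| := by
      intro i hi hle
      have := Real.log_le_log (half_pos (hx0 i)) hle
      rw [Real.log_div (hx0 i).ne' two_ne_zero] at this
      linarith
    have hlogpow : Real.log (8 * M * L ^ n) = Real.log (8 * M) + n * Real.log L := by
      rw [Real.log_mul (by positivity) (by positivity), Real.log_pow]
    have horbit : ∀ j ≤ n + 1,
        |(fun x : ℝ => P.eval x + c)^[j] 0| ≤ max R₀ R := by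
      intro j hj
      rw [← gcIter_real]
      by_contra! hlt
      have h1 := (hesc c j (le_trans (max_le_max le_rfl hcR) hlt.le) (n + 1) hj).1
      have h2 : 0 ≤ Real.log |(gcIter g c (n + 1) : ℝ)| :=
        Real.log_nonneg (by linarith [le_max_left R₀ |(c : ℝ)|])
      linarith
    have hδ : 8 * M * L ^ n * |(fun x : ℝ => P.eval x + c)^[n + 1] 0| ≤ 1 := by
      rw [← gcIter_real]
      have hpos := hx0 n
      rw [← Real.log_nonpos_iff (by positivity), Real.log_mul (by positivity) hpos.ne', hlogpow]
      linarith
    rcases iterate_near_return hL hM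
      (fun x y hx hy => by rw [add_sub_add_right_eq_sub]; exact hlip x y hx hy)
      (fun x hx => by
        rw [add_sub_add_right_eq_sub, ← coeff_zero_eq_eval_zero, hP, coeff_map, hg.2.1]
        simpa using hsq x hx) horbit hδ hnk with h | ⟨j, hj, h⟩
    · rw [← gcIter_real, ← gcIter_real] at h
      exact hhalf n (neg_log_Bn_le hc n) h
    · rw [← gcIter_real, ← gcIter_real, ← gcIter_real] at h
      have hyj : y j ≤ y n := by
        rcases le_max_iff.mp (le_max_of_mul_le_add (by linarith) hy0 hrec hj.le) with h | h <;>
          linarith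
      have hxj : -y n ≤ Real.log |(gcIter g c (j + 1) : ℝ)| := by
        have : -y j ≤ _ := neg_log_Bn_le hc j
        linarith
      have hclose : 8 * M * L ^ n * |(gcIter g c (n + 1) : ℝ)| ^ 2 ≤
          |(gcIter g c (j + 1) : ℝ)| := by
        have hpos := hx0 n
        rw [← Real.log_le_log_iff (by positivity) (hx0 j), Real.log_mul (by positivity)
          (by positivity), hlogpow, Real.log_pow]
        push_cast
        linarith
      rw [sq_abs] at hclose
      refine hhalf j hxj ?_
      have := abs_sub_abs_le_abs_sub (gcIter g c (j + 1) : ℝ) (gcIter g c (k + 1) : ℝ)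
      rw [abs_sub_comm] at this
      linarith
  linarith

/-- There are at most `N` indices at which the numerator inequality fails. -/
def ExceptionsAtMost (g : ℤ[X]) (c : ℚ) (N : ℕ) : Prop :=
  ∃ J : Finset ℕ, J.card ≤ N ∧ ∀ n, n ∉ J → NumeratorDominates g c n

lemma ExceptionsAtMost.mono {g : ℤ[X]} {c : ℚ} {N N' : ℕ} (h : ExceptionsAtMost g c N)
    (hN : N ≤ N') : ExceptionsAtMost g c N' :=
  let ⟨J, hJ, hJ'⟩ := h
  ⟨J, hJ.trans hN, hJ'⟩

lemma exceptionsAtMost_of_unique {g : ℤ[X]} {c : ℚ} {N : ℕ}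
    (h : ∀ n, N ≤ n → ∀ k, n < k → ¬ NumeratorDominates g c n → NumeratorDominates g c k) :
    ExceptionsAtMost g c (N + 1) := by
  by_cases hb : ∃ n, N ≤ n ∧ ¬ NumeratorDominates g c n
  · obtain ⟨n, hn, hbad⟩ := hb
    refine ⟨insert n (Finset.range N), (Finset.card_insert_le _ _).trans (by simp), ?_⟩
    intro k hk
    simp only [Finset.mem_insert, Finset.mem_range, not_or, not_lt] at hk
    by_contra hk'
    rcases lt_or_gt_of_ne hk.1 with hlt | hlt
    · exact hbad (h k hk.2 n hlt hk')
    · exact hk' (h n hn k hlt hbad)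
  · push Not at hb
    exact ⟨Finset.range N, by simp, fun k hk => hb k (by simpa using hk)⟩

lemma exists_log_abs_An_succ {g : ℤ[X]} (hg : IsX2Divisible g) (hd : 3 ≤ g.natDegree) :
    ∃ R K : ℝ, 4 ≤ R ∧ 0 ≤ K ∧ ∀ c ∈ Sg g, ∀ m, max R |(c : ℝ)| ≤ |(gcIter g c (m + 1) : ℝ)| →
      ∀ n, m ≤ n → 4 * |(gcIter g c (n + 1) : ℝ)| ≤ |(gcIter g c (n + 2) : ℝ)| ∧
        g.natDegree * Real.log |(An g c n : ℝ)| ≤ K + Real.log |(An g c (n + 1) : ℝ)| := by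
  obtain ⟨R, hR, hesc⟩ := exists_escape hg hd
  refine ⟨R, Real.log 4 + g.natDegree * Real.log g.leadingCoeff.natAbs, hR,
    add_nonneg (Real.log_nonneg (by norm_num))
      (mul_nonneg (by positivity) (Real.log_natCast_nonneg _)), fun c hc m hm n hn => ?_⟩
  obtain ⟨-, h4, hpow⟩ := hesc c (m + 1) hm (n + 1) (by omega)
  refine ⟨h4, ?_⟩
  have hpos : ∀ i, 0 < |(gcIter g c (i + 1) : ℝ)| := fun i =>
    abs_pos.mpr (by exact_mod_cast gcIter_ne_zero hc i)
  have h1 := Real.log_le_log (pow_pos (hpos n) _) hpow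
  rw [Real.log_pow, Real.log_mul (by norm_num) (hpos (n + 1)).ne'] at h1
  have h2 := log_Bn_succ hg c n
  rw [log_abs_An hc, log_abs_An hc, mul_add]
  linarith

/-- For each individual parameter there are only finitely many exceptions. -/
lemma exists_exceptionsAtMost {g : ℤ[X]} (hg : IsX2Divisible g) (hd : 3 ≤ g.natDegree)
    {c : ℚ} (hc : c ∈ Sg g) : ∃ N, ExceptionsAtMost g c N := by
  obtain ⟨κ, hκ0, hκ⟩ := exists_log_abs_An_le hg
  obtain ⟨R, K, hR, hK, hesc⟩ := exists_log_abs_An_succ hg hd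
  have hY := heightBound_pos hκ0 c
  have hd0 : (0 : ℝ) < g.natDegree := by exact_mod_cast (by omega)
  by_cases hbdd : ∃ m, max R |(c : ℝ)| ≤ |(gcIter g c (m + 1) : ℝ)|
  · obtain ⟨m, hm⟩ := hbdd
    have hpow : ∀ k : ℕ, (4 : ℝ) ^ k ≤ |(gcIter g c (m + k + 1) : ℝ)| := by
      intro k
      induction k with
      | zero => simpa using (by linarith [le_max_left R |(c : ℝ)|] : (1 : ℝ) ≤ _)
      | succ k ih =>
        have := (hesc c hc m hm (m + k) (by omega)).1
        rw [pow_succ, ← add_assoc]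
        linarith
    obtain ⟨k, hk⟩ := pow_unbounded_of_one_lt (Real.exp (K + 1)) (show (1 : ℝ) < 4 by norm_num)
    have hA : K + 1 ≤ Real.log |(An g c (m + k) : ℝ)| := by
      have h1 := Real.log_le_log (Real.exp_pos _) (hk.le.trans (hpow k))
      rw [Real.log_exp] at h1
      have h2 := log_Bn_nonneg g c (m + k)
      rw [log_abs_An hc]
      linarith
    set a := Real.log |(An g c (m + k) : ℝ)| with ha
    obtain ⟨N, hN⟩ := exists_numeratorDominates hg hκ0 hκ
      (θ := a / (2 * g.natDegree ^ (m + k)) / heightBound κ c)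
      (div_pos (div_pos (by linarith) (by positivity)) hY) (m + k)
    refine ⟨N, Finset.range N, by simp, fun n hn => hN c hc (fun n hn => ?_) n (by simpa using hn)⟩
    rw [← mul_assoc, div_mul_cancel₀ _ hY.ne']
    exact geometric_growth (a := fun n => Real.log |(An g c n : ℝ)|) hd hK
      (fun n hn => (hesc c hc m hm n (by omega)).2) (by linarith) hn
  · push Not at hbdd
    set w := g.natDegree * Real.log g.leadingCoeff.natAbs with hw
    have hw0 : 0 ≤ w := mul_nonneg (by positivity) (Real.log_natCast_nonneg _)
    obtain ⟨m, hm⟩ : ∃ m, w + 1 ≤ Real.log (Bn g c m) := by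
      by_contra! hlt
      refine hc ((Rat.finite_setOf_den_le_abs_le ⌈Real.exp (w + 1)⌉₊ (max R |(c : ℝ)|)).subset ?_)
      rintro _ ⟨n, rfl⟩
      refine ⟨?_, (hbdd n).le⟩
      have h1 : (0 : ℝ) < Bn g c n := by exact_mod_cast Rat.den_pos _
      have h2 := ((Real.log_lt_iff_lt_exp h1).mp (hlt n)).le.trans (Nat.le_ceil _)
      exact_mod_cast h2
    set a := Real.log (Bn g c m) with ha
    obtain ⟨N, hN⟩ := exists_unique_exception hg hd hκ0 hκ |(c : ℝ)|
      (θ := a / (2 * g.natDegree ^ m) / heightBound κ c)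
      (div_pos (div_pos (by linarith) (by positivity)) hY) m
    refine ⟨N + 1, exceptionsAtMost_of_unique (hN c hc le_rfl fun n hn => ?_)⟩
    rw [← mul_assoc, div_mul_cancel₀ _ hY.ne']
    exact geometric_growth (a := fun n => Real.log (Bn g c n)) hd hw0
      (fun n _ => log_Bn_succ hg c n) (by linarith) hn

lemma exists_exceptionsAtMost_of_large {g : ℤ[X]} (hg : IsX2Divisible g) (hd : 3 ≤ g.natDegree) :
    ∃ (R : ℝ) (N : ℕ), ∀ c ∈ Sg g, R ≤ |(c : ℝ)| → ExceptionsAtMost g c N := by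
  obtain ⟨κ, hκ0, hκ⟩ := exists_log_abs_An_le hg
  obtain ⟨R, K, hR, hK, hesc⟩ := exists_log_abs_An_succ hg hd
  obtain ⟨N, hN⟩ := exists_numeratorDominates hg hκ0 hκ (θ := 1 / 8) (by norm_num) 0
  refine ⟨max R (Real.exp (max K κ)), N, fun c hc hcR => ⟨Finset.range N, by simp, fun n hn =>
    hN c hc (fun n _ => ?_) n (by simpa using hn)⟩⟩
  have hRc := (le_max_left _ _).trans hcR
  have hlog : max K κ ≤ Real.log |(c : ℝ)| := by
    rw [Real.le_log_iff_exp_le (by linarith)]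
    exact (le_max_right _ _).trans hcR
  have h1 : Real.log |(An g c 0 : ℝ)| = Real.log |(c : ℝ)| + Real.log c.den := by
    rw [log_abs_An hc, log_Bn_zero hg, gcIter_one hg.2.1]
  have hden : 0 ≤ Real.log (c.den : ℝ) := Real.log_natCast_nonneg _
  have hgrow := geometric_growth (a := fun n => Real.log |(An g c n : ℝ)|) (m := 0) hd hK
    (fun n hn => (hesc c hc 0 (by rw [gcIter_one hg.2.1, max_eq_right hRc]) n hn).2)
    (by linarith [le_max_left K κ]) (Nat.zero_le n)
  simp only [pow_zero, mul_one] at hgrow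
  refine le_trans ?_ hgrow
  rw [← mul_assoc]
  gcongr
  rw [heightBound, max_eq_right (by linarith), h1]
  linarith [le_max_right K κ]

lemma exists_exceptionsAtMost_of_den {g : ℤ[X]} (hg : IsX2Divisible g) (hd : 3 ≤ g.natDegree)
    (R : ℝ) :
    ∃ Q N : ℕ, ∀ c ∈ Sg g, |(c : ℝ)| ≤ R → Q ≤ c.den → ExceptionsAtMost g c N := by
  obtain ⟨κ, hκ0, hκ⟩ := exists_log_abs_An_le hg
  obtain ⟨N, hN⟩ := exists_unique_exception hg hd hκ0 hκ R (θ := 1 / 4) (by norm_num) 0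
  set w := g.natDegree * Real.log g.leadingCoeff.natAbs with hw
  have hw0 : 0 ≤ w := mul_nonneg (by positivity) (Real.log_natCast_nonneg _)
  set T := max w (2 * (κ + Real.log (max 1 R)))
  refine ⟨⌈Real.exp T⌉₊, N + 1, fun c hc hcR hQ =>
    exceptionsAtMost_of_unique (hN c hc hcR fun n _ => ?_)⟩
  have hlog : T ≤ Real.log c.den := by
    rw [Real.le_log_iff_exp_le (by exact_mod_cast c.den_pos)]
    exact (Nat.le_ceil _).trans (by exact_mod_cast hQ)
  have hgrow := geometric_growth (a := fun n => Real.log (Bn g c n)) (m := 0) hd hw0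
    (fun n _ => log_Bn_succ hg c n)
    (by rw [log_Bn_zero hg]; exact (le_max_left _ _).trans hlog) (Nat.zero_le n)
  simp only [pow_zero, mul_one] at hgrow
  refine le_trans ?_ hgrow
  rw [← mul_assoc]
  gcongr
  have h1 : Real.log (max 1 |(c : ℝ)|) ≤ Real.log (max 1 R) :=
    Real.log_le_log (by positivity) (max_le_max le_rfl hcR)
  have h2 := (le_max_right _ _).trans hlog
  rw [heightBound, log_Bn_zero hg]
  linarith

/-- Proposition 2.6 (Main Proposition): every `x²`-divisible `g ∈ ℤ[x]` of degree `d ≥ 3`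
has rapidly increasing numerators on `S_g`. -/
theorem rapidly_increasing_numerators_on_Sg (g : ℤ[X]) (hg : IsX2Divisible g)
    (hd : 3 ≤ g.natDegree) :
    RapidlyIncreasingNumerators g (Sg g) := by
  obtain ⟨R, N₁, h₁⟩ := exists_exceptionsAtMost_of_large hg hd
  obtain ⟨Q, N₂, h₂⟩ := exists_exceptionsAtMost_of_den hg hd R
  have hfin := Rat.finite_setOf_den_le_abs_le Q R
  choose! f hf using fun c (hc : c ∈ Sg g) => exists_exceptionsAtMost hg hd hc
  set N₃ := hfin.toFinset.sup f
  refine ⟨N₁ + N₂ + N₃ + 1, by omega, fun c hc => ?_⟩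
  have key : ExceptionsAtMost g c (N₁ + N₂ + N₃ + 1) := by
    rcases le_total R |(c : ℝ)| with hR | hR
    · exact (h₁ c hc hR).mono (by omega)
    rcases le_total Q c.den with hQ | hQ
    · exact (h₂ c hc hR hQ).mono (by omega)
    have : f c ≤ N₃ := Finset.le_sup (f := f) (hfin.mem_toFinset.mpr ⟨hQ, hR⟩)
    exact (hf c hc).mono (by omega)
  obtain ⟨J, hJ, hJ'⟩ := key
  exact ⟨J, hJ, fun n _ hn => hJ' n hn⟩
end
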